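/- A finite-dimensional graded division algebra \(\mathsf{D}\) with center \(\mathsf{F}\) has a maximal graded subfield that is Galois (respectively, normal) over \(\mathsf{F}\) if and only if the division algebra \(\mathsf{D}_0\) has a maximal subfield that is Galois (respectively, normal) over the field \(\mathsf{F}_0\). -/

import Mathlib

noncomputable section

namespace GradedDivPaper

variable {Γ : Type*} [AddCommGroup Γ] [DecidableEq Γ]
variable {D : Type*} [Ring D]

/-- The (additive) group `Γ` is torsion-free. -/
def TorsionFree (Γ : Type*) [AddCommGroup Γ] : Prop :=
  ∀ (γ : Γ) (n : ℕ), n ≠ 0 → n • γ = 0 → γ = 0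

/-- A `Γ`-graded ring is a graded division ring if `1 ≠ 0` and every nonzero
homogeneous element is a unit. -/
def IsGradedDivisionRing (𝒜 : Γ → AddSubgroup D) [GradedRing 𝒜] : Prop :=
  (0 : D) ≠ 1 ∧ ∀ (γ : Γ), ∀ x ∈ 𝒜 γ, x ≠ 0 → IsUnit x

/-- A subring `E` of a graded ring is a graded subring if it contains all homogeneous
components of each of its elements. -/
def IsGradedSubring (𝒜 : Γ → AddSubgroup D) [GradedRing 𝒜] (E : Subring D) : Prop :=
  ∀ x ∈ E, ∀ γ : Γ, (DirectSum.decompose 𝒜 x γ : D) ∈ E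

/-- A graded subring which is itself a graded division ring (nonzero homogeneous elements
of `E` are invertible in `E`). -/
def IsGradedDivSubring (𝒜 : Γ → AddSubgroup D) [GradedRing 𝒜] (E : Subring D) : Prop :=
  IsGradedSubring 𝒜 E ∧
    ∀ (γ : Γ), ∀ x ∈ E, x ∈ 𝒜 γ → x ≠ 0 → ∃ y ∈ E, x * y = 1 ∧ y * x = 1

/-- A graded subfield: a commutative graded division subring. -/
def IsGradedSubfield (𝒜 : Γ → AddSubgroup D) [GradedRing 𝒜] (K : Subring D) : Prop :=
  IsGradedDivSubring 𝒜 K ∧ ∀ x ∈ K, ∀ y ∈ K, x * y = y * x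

/-- The grade set `Γ_E` of a subring `E`: the degrees in which `E` has nonzero
homogeneous elements. -/
def gradeSet (𝒜 : Γ → AddSubgroup D) (E : Subring D) : Set Γ :=
  {γ : Γ | ∃ x : D, x ∈ E ∧ x ∈ 𝒜 γ ∧ x ≠ 0}

/-- The index `|A : B|` of subsets of `Γ`: the number of classes of `A` modulo
translation by `B`. -/
def addSetIndex (A B : Set Γ) : ℕ :=
  Nat.card (Quot (fun x y : A => (x : Γ) - (y : Γ) ∈ B))

/-- `[R : S]`: the rank of the ring `R` as a module over a subring `S`. -/
def dimOver {R : Type*} [Ring R] (S : Subring R) : ℕ := Module.finrank S R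

/-- `R` has finite rank over the subring `S`. -/
def finiteOver {R : Type*} [Ring R] (S : Subring R) : Prop := Module.Finite S R

/-- `[A : B]`: the rank of a subring `A` of `R` over a subring `B` (i.e. over `B ∩ A`). -/
def relDim {R : Type*} [Ring R] (B A : Subring R) : ℕ :=
  Module.finrank (B.comap A.subtype) A

/-- The degree-0 component of a graded ring, as a subring. -/
def grade0 (𝒜 : Γ → AddSubgroup D) [GradedRing 𝒜] : Subring D where
  carrier := 𝒜 0
  zero_mem' := (𝒜 0).zero_mem
  add_mem' := fun ha hb => (𝒜 0).add_mem ha hb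
  neg_mem' := fun ha => (𝒜 0).neg_mem ha
  one_mem' := SetLike.one_mem_graded 𝒜
  mul_mem' := fun ha hb => by simpa using SetLike.mul_mem_graded ha hb

/-- `L/F` is a Galois extension (inside an ambient ring `R`): `F ≤ L` and `F` is exactly
the fixed ring of the group of ring automorphisms of `L` fixing `F` pointwise. -/
def IsGaloisExt {R : Type*} [Ring R] (F L : Subring R) : Prop :=
  F ≤ L ∧ ∀ x : L,
    (∀ σ : L ≃+* L, (∀ y : L, (y : R) ∈ F → σ y = y) → σ x = x) → (x : R) ∈ F

/-- `p` is the minimal polynomial of `c` over the subring `F`: the monic polynomial with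
coefficients in `F` annihilating `c` of least degree. -/
def IsMinPolyOf {R : Type*} [Ring R] (F : Subring R) (c : R) (p : Polynomial F) : Prop :=
  p.Monic ∧ Polynomial.eval₂ F.subtype c p = 0 ∧
    ∀ q : Polynomial F, q.Monic → Polynomial.eval₂ F.subtype c q = 0 → p.degree ≤ q.degree

/-- The polynomial `p` over `F` splits into linear factors over `L`. -/
def SplitsIn {R : Type*} [Ring R] {F L : Subring R} (h : F ≤ L) (p : Polynomial F) : Prop :=
  ∃ s : List L,
    p.map (Subring.inclusion h) = (s.map fun a => Polynomial.X - Polynomial.C a).prod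

/-- Normality for an extension of graded subfields: the minimal polynomial over `F` of
every homogeneous element of `L` splits over `L`. -/
def IsNormalExtGr (𝒜 : Γ → AddSubgroup D) [GradedRing 𝒜] (F L : Subring D) : Prop :=
  ∃ h : F ≤ L, ∀ c ∈ L, (∃ γ : Γ, c ∈ 𝒜 γ) →
    ∀ p : Polynomial F, IsMinPolyOf F c p → SplitsIn h p

/-- Normality for an (ungraded) extension of subfields: the minimal polynomial over `F`
of every element of `L` splits over `L`. -/
def IsNormalExt {R : Type*} [Ring R] (F L : Subring R) : Prop :=
  ∃ h : F ≤ L, ∀ c ∈ L, ∀ p : Polynomial F, IsMinPolyOf F c p → SplitsIn h p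

/-- `K` is a (commutative) subfield of the subring `A`. -/
def IsSubfieldOf {R : Type*} [Ring R] (A K : Subring R) : Prop :=
  K ≤ A ∧ (∀ x ∈ K, ∀ y ∈ K, x * y = y * x) ∧
    ∀ x ∈ K, x ≠ 0 → ∃ y ∈ K, x * y = 1 ∧ y * x = 1

/-- `K` is a maximal subfield of the subring `A`. -/
def IsMaxSubfieldOf {R : Type*} [Ring R] (A K : Subring R) : Prop :=
  IsSubfieldOf A K ∧ ∀ K' : Subring R, IsSubfieldOf A K' → K ≤ K' → K' = K

/-- `T` is a maximal graded subfield of the graded subring `A`. -/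
def IsMaxGradedSubfieldOf (𝒜 : Γ → AddSubgroup D) [GradedRing 𝒜] (A T : Subring D) : Prop :=
  IsGradedSubfield 𝒜 T ∧ T ≤ A ∧
    ∀ T' : Subring D, IsGradedSubfield 𝒜 T' → T' ≤ A → T ≤ T' → T' = T

/-- The canonical subalgebra `𝖴 = 𝖣₀ ⊗_{𝖥₀} 𝖥`: the subring generated by `𝖣₀` and `𝖥`. -/
def Uc (𝒜 : Γ → AddSubgroup D) [GradedRing 𝒜] (F : Subring D) : Subring D :=
  grade0 𝒜 ⊔ F

/-- The canonical subalgebra `𝖹 = Z(𝖣₀) ⊗_{𝖥₀} 𝖥`: the subring generated by the center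
of `𝖣₀` and `𝖥`. -/
def Zc (𝒜 : Γ → AddSubgroup D) [GradedRing 𝒜] (F : Subring D) : Subring D :=
  (Subring.centralizer (grade0 𝒜 : Set D) ⊓ grade0 𝒜) ⊔ F

/-- The canonical subalgebra `𝖢 = C_𝖣(𝖴)`. -/
def Cc (𝒜 : Γ → AddSubgroup D) [GradedRing 𝒜] (F : Subring D) : Subring D :=
  Subring.centralizer (Uc 𝒜 F : Set D)

/-- The canonical subalgebra `𝖤 = C_𝖣(𝖹)`. -/
def Ec (𝒜 : Γ → AddSubgroup D) [GradedRing 𝒜] (F : Subring D) : Subring D :=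
  Subring.centralizer (Zc 𝒜 F : Set D)

end GradedDivPaper

namespace GradedDivPaper

section SkolemNoether

variable {A : Type*} [DivisionRing A]

/-- Artin–Whaples: a family independent over the center is independent for the two-sided
multiplication action. -/
theorem artin_whaples {ι : Type*} {b : ι → A} (hb : LinearIndependent (Subring.center A) b)
    (s : Finset ι) :
    ∀ a : ι → A, (∀ x, ∑ i ∈ s, a i * x * b i = 0) → ∀ i ∈ s, a i = 0 := by
  classical
  induction s using Finset.induction_on with
  | empty => simp
  | insert j s hj ih =>
    intro a ha
    have haj : a j = 0 := by
      by_contra h0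
      have hrel : ∀ x, x * b j + ∑ i ∈ s, (a j)⁻¹ * a i * x * b i = 0 := by
        intro x
        have := congrArg (fun y => (a j)⁻¹ * y) (ha x)
        simp only [Finset.sum_insert hj, mul_add, Finset.mul_sum, mul_zero, ← mul_assoc,
          inv_mul_cancel₀ h0, one_mul] at this
        exact this
      have hcen : ∀ i ∈ s, (a j)⁻¹ * a i ∈ Subring.center A := by
        intro i hi
        rw [Subring.mem_center_iff]
        intro c
        have := ih (fun i => c * ((a j)⁻¹ * a i) - (a j)⁻¹ * a i * c) (by
          intro x
          have h1 := congrArg (fun y => c * y) (hrel x)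
          have h2 := hrel (c * x)
          simp only [mul_add, Finset.mul_sum, mul_zero] at h1
          have h3 : ∑ i ∈ s, (c * ((a j)⁻¹ * a i) - (a j)⁻¹ * a i * c) * x * b i =
              (c * (x * b j) + ∑ i ∈ s, c * ((a j)⁻¹ * a i * x * b i)) -
              (c * x * b j + ∑ i ∈ s, (a j)⁻¹ * a i * (c * x) * b i) := by
            rw [mul_assoc c x, add_sub_add_left_eq_sub, ← Finset.sum_sub_distrib]
            refine Finset.sum_congr rfl fun i _ => ?_
            simp only [sub_mul, mul_assoc]
          rw [h3, h1, h2, sub_zero]) i hi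
        exact sub_eq_zero.mp this
      let g : ι → Subring.center A := fun i =>
        if i = j then 1 else if hi : i ∈ s then ⟨_, hcen i hi⟩ else 0
      have hz : ∑ i ∈ insert j s, g i • b i = 0 := by
        rw [Finset.sum_insert hj]
        have h1 := hrel 1
        simp only [one_mul, mul_one] at h1
        rw [← h1]
        congr 1
        · simp [g]
        · refine Finset.sum_congr rfl fun i hi => ?_
          have : i ≠ j := fun h => hj (h ▸ hi)
          simp [g, this, hi, Subring.smul_def]
      have := linearIndependent_iff'.mp hb _ g hz j (Finset.mem_insert_self _ _)
      simp [g] at this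
    intro i hi
    rcases Finset.mem_insert.mp hi with rfl | hi
    · exact haj
    · exact ih a (fun x => by simpa [Finset.sum_insert hj, haj] using ha x) i hi

/-- Skolem–Noether for automorphisms of a division ring finite over its center. -/
theorem exists_intertwiner [Module.Finite (Subring.center A) A] (φ : A ≃+* A)
    (hφ : ∀ z ∈ Subring.center A, φ z = z) : ∃ y : A, y ≠ 0 ∧ ∀ c, c * y = y * φ c := by
  classical
  let K := Subring.center A
  let b := Module.finBasis K A
  have hbφ : LinearIndependent K (fun i => φ (b i)) := by
    rw [Fintype.linearIndependent_iff]
    intro g hg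
    refine Fintype.linearIndependent_iff.mp b.linearIndependent g (φ.injective ?_)
    rw [map_zero, ← hg, map_sum]
    refine Finset.sum_congr rfl fun i _ => ?_
    simp only [Subring.smul_def, smul_eq_mul, map_mul, hφ _ (g i).2]
  have hcomm : ∀ (z : K) (x : A), (z : A) * x = x * z := fun z x =>
    ((Subring.mem_center_iff.mp z.2) x).symm
  let Φ : (Fin (Module.finrank K A) → A) →ₗ[K] Module.End K A :=
    { toFun := fun a =>
        { toFun := fun x => ∑ i, a i * x * b i
          map_add' := fun x y => by simp only [mul_add, add_mul, Finset.sum_add_distrib]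
          map_smul' := fun z x => by
            simp only [Subring.smul_def, smul_eq_mul, RingHom.id_apply, Finset.mul_sum]
            refine Finset.sum_congr rfl fun i _ => ?_
            rw [← mul_assoc, ← mul_assoc, ← mul_assoc, hcomm z (a i)] }
      map_add' := fun a a' => by
        ext x; simp [add_mul, Finset.sum_add_distrib]
      map_smul' := fun z a => by
        ext x; simp [Subring.smul_def, Finset.mul_sum, mul_assoc] }
  have hΦ : Function.Injective Φ := by
    rw [← LinearMap.ker_eq_bot, LinearMap.ker_eq_bot']
    intro a ha
    funext i
    exact artin_whaples b.linearIndependent Finset.univ a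
      (fun x => by simpa [Φ] using LinearMap.congr_fun ha x) i (Finset.mem_univ _)
  have hsurj : Function.Surjective Φ := by
    refine (LinearMap.injective_iff_surjective_of_finrank_eq_finrank ?_).mp hΦ
    rw [Module.finrank_linearMap, Module.finrank_pi_fintype]
    simp
  have hn : 0 < Module.finrank K A := Module.finrank_pos
  let i₀ : Fin (Module.finrank K A) := ⟨0, hn⟩
  obtain ⟨a, ha⟩ := hsurj ((LinearMap.toSpanSingleton K A 1).comp (b.coord i₀))
  have ha' : ∀ x, ∑ i, a i * x * b i = (b.coord i₀ x : K) := fun x => by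
    have := LinearMap.congr_fun ha x
    simpa [Φ, Subring.smul_def] using this
  have hane : ∃ i, a i ≠ 0 := by
    by_contra! h
    have := ha' (b i₀)
    simp [h] at this
  have hcas : ∀ c j, c * a j = ∑ i, (b.repr (b i * c) j : A) * a i := by
    intro c j
    have := artin_whaples b.linearIndependent Finset.univ
      (fun j => c * a j - ∑ i, (b.repr (b i * c) j : A) * a i) (by
        intro x
        simp only [sub_mul, Finset.sum_sub_distrib, Finset.sum_mul]
        have h1 : ∑ j, c * a j * x * b j = c * (b.coord i₀ x : K) := by
          rw [← ha', Finset.mul_sum]; simp only [mul_assoc]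
        have h2 : ∑ j, ∑ i, (b.repr (b i * c) j : A) * a i * x * b j =
            (b.coord i₀ x : K) * c := by
          rw [Finset.sum_comm, ← ha', Finset.sum_mul]
          refine Finset.sum_congr rfl fun i _ => ?_
          conv_rhs => rw [mul_assoc, ← b.sum_repr (b i * c), Finset.mul_sum]
          refine Finset.sum_congr rfl fun j _ => ?_
          simp only [Subring.smul_def, smul_eq_mul]
          rw [mul_assoc _ (a i) x, hcomm _ (a i * x), mul_assoc _ _ (b j)]
        rw [h1, h2, hcomm, sub_self]) j (Finset.mem_univ _)
    exact sub_eq_zero.mp this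
  obtain ⟨w, hw⟩ : ∃ w, ∑ i, a i * w * φ (b i) ≠ 0 := by
    by_contra! h
    obtain ⟨i, hi⟩ := hane
    exact hi (artin_whaples hbφ Finset.univ a h i (Finset.mem_univ _))
  refine ⟨_, hw, fun c => ?_⟩
  have h1 : ∀ i, φ (b i) * φ c = ∑ j, (b.repr (b i * c) j : A) * φ (b j) := by
    intro i
    rw [← map_mul]
    conv_lhs => rw [← b.sum_repr (b i * c), map_sum]
    refine Finset.sum_congr rfl fun j _ => ?_
    simp only [Subring.smul_def, smul_eq_mul, map_mul, hφ _ (Subtype.prop _)]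
  have h2 : ∀ j, c * (a j * w * φ (b j)) =
      ∑ i, (b.repr (b i * c) j : A) * a i * w * φ (b j) := fun j => by
    rw [← mul_assoc, ← mul_assoc, hcas, Finset.sum_mul, Finset.sum_mul]
  rw [Finset.mul_sum, Finset.sum_congr rfl fun j _ => h2 j, Finset.sum_comm, Finset.sum_mul]
  refine Finset.sum_congr rfl fun i _ => ?_
  rw [mul_assoc _ (φ (b i)), h1, Finset.mul_sum]
  refine Finset.sum_congr rfl fun j _ => ?_
  rw [mul_assoc _ (a i) w, hcomm _ (a i * w), mul_assoc _ _ (φ (b j))]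

end SkolemNoether

section Conjugates

open Polynomial

theorem exists_conjugates_of_isFractionRing {A L k K : Type*} [CommRing A] [CommRing L]
    [Field k] [Field K] [Algebra A L] [Algebra A k] [IsFractionRing A k]
    [Algebra L K] [IsFractionRing L K] [Algebra k K]
    (hAL : Function.Injective (algebraMap A L))
    (hcomp : (algebraMap k K).comp (algebraMap A k) = (algebraMap L K).comp (algebraMap A L))
    (sep : Prop)
    (hsat : ∀ a : A, a ≠ 0 → ∀ x : L, algebraMap A L a * x ∈ (algebraMap A L).range →
      x ∈ (algebraMap A L).range)
    (S : Set L) (hS : Algebra.adjoin A S = ⊤)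
    (hgood : ∀ c ∈ S, ∃ s : Multiset L, c ∈ s ∧ (sep → s.Nodup) ∧
      ∃ p : A[X], p.map (algebraMap A L) = (s.map fun a => X - C a).prod) (c : L) :
    ∃ s : Multiset L, c ∈ s ∧ (sep → s.Nodup) ∧ (∀ a ∈ s, ∃ σ : L ≃ₐ[A] L, σ c = a) ∧
      ∃ p : A[X], p.map (algebraMap A L) = (s.map fun a => X - C a).prod ∧
        ∀ q : A[X], q.Monic → aeval c q = 0 → q.degree ≤ p.degree → q = p := by
  classical
  have : IsDomain L := (IsFractionRing.injective L K).isDomain _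
  have : IsDomain A := hAL.isDomain _
  set ι := algebraMap L K with hιdef
  have hι : Function.Injective ι := IsFractionRing.injective L K
  have hcomp' : ∀ a, algebraMap k K (algebraMap A k a) = ι (algebraMap A L a) :=
    fun a => congrArg (fun f => f a) hcomp
  have hAk : Function.Injective (algebraMap A k) := IsFractionRing.injective A k
  -- transfer of split polynomials to `k`
  have hmapK : ∀ (p : A[X]) (s : Multiset L),
      p.map (algebraMap A L) = (s.map fun a => X - C a).prod →
      (p.map (algebraMap A k)).map (algebraMap k K) = ((s.map ι).map fun a => X - C a).prod := by
    intro p s h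
    rw [Polynomial.map_map, hcomp, ← Polynomial.map_map, h, Polynomial.map_multiset_prod,
      Multiset.map_map, Multiset.map_map]
    simp
  have hmon : ∀ (p : A[X]) (s : Multiset L),
      p.map (algebraMap A L) = (s.map fun a => X - C a).prod → p.Monic := by
    intro p s h
    refine Polynomial.monic_of_injective hAL ?_
    rw [h]
    exact monic_multiset_prod_of_monic _ _ fun a _ => monic_X_sub_C a
  have hgen : ∀ x ∈ S, IsIntegral k (ι x) ∧
      ((minpoly k (ι x)).map (algebraMap k K)).Splits ∧ (sep → IsSeparable k (ι x)) := by
    intro x hx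
    obtain ⟨s, hxs, hs, p, hp⟩ := hgood x hx
    have hP := hmapK p s hp
    have hPm : (p.map (algebraMap A k)).Monic := (hmon p s hp).map _
    have hroot : aeval (ι x) (p.map (algebraMap A k)) = 0 := by
      rw [aeval_def, eval₂_eq_eval_map, hP, eval_multiset_prod]
      refine Multiset.prod_eq_zero ?_
      simp only [Multiset.map_map, Multiset.mem_map]
      exact ⟨x, hxs, by simp⟩
    have hdvd := minpoly.dvd k (ι x) hroot
    have hsp : ((p.map (algebraMap A k)).map (algebraMap k K)).Splits := by
      rw [hP]
      exact Splits.multisetProd (by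
        intro f hf
        obtain ⟨a, _, rfl⟩ := Multiset.mem_map.mp hf
        exact Splits.X_sub_C a)
    refine ⟨⟨_, hPm, hroot⟩, hsp.of_dvd (hPm.map _).ne_zero (Polynomial.map_dvd _ hdvd), ?_⟩
    intro h
    refine Separable.of_dvd ?_ hdvd
    rw [← separable_map (algebraMap k K), ← nodup_roots_iff_of_splits (hPm.map _).ne_zero hsp, hP,
      roots_multiset_prod_X_sub_C]
    exact (hs h).map hι
  have htop : IntermediateField.adjoin k (ι '' S) = ⊤ := by
    rw [eq_top_iff]
    have hL : ∀ x : L, ι x ∈ IntermediateField.adjoin k (ι '' S) := by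
      intro x
      have hx : x ∈ Algebra.adjoin A S := hS ▸ Algebra.mem_top
      induction hx using Algebra.adjoin_induction with
      | mem x hx => exact IntermediateField.subset_adjoin _ _ ⟨x, hx, rfl⟩
      | algebraMap a =>
        rw [← hcomp']
        exact IntermediateField.algebraMap_mem _ _
      | add x y _ _ hx hy => rw [map_add]; exact add_mem hx hy
      | mul x y _ _ hx hy => rw [map_mul]; exact mul_mem hx hy
    intro z _
    obtain ⟨x, y, _, rfl⟩ := IsFractionRing.div_surjective (A := L) z
    exact div_mem (hL x) (hL y)
  have h_int : Algebra.IsIntegral k K := by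
    have h1 : Algebra.IsAlgebraic k (IntermediateField.adjoin k (ι '' S)) :=
      IntermediateField.isAlgebraic_adjoin (by
        rintro _ ⟨x, hx, rfl⟩
        exact (hgen x hx).1)
    refine ⟨fun z => ?_⟩
    have hz : z ∈ IntermediateField.adjoin k (ι '' S) := htop ▸ IntermediateField.mem_top
    have := (h1.isAlgebraic ⟨z, hz⟩).isIntegral
    exact this.map (IntermediateField.val _)
  have hnormal : Normal k K := by
    rw [normal_iff]
    refine fun z => ⟨h_int.isIntegral z, ?_⟩
    refine IntermediateField.splits_of_mem_adjoin k K (S := ι '' S) ?_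
      (htop ▸ IntermediateField.mem_top)
    rintro _ ⟨x, hx, rfl⟩
    exact ⟨(hgen x hx).1, (hgen x hx).2.1⟩
  have hsepK : sep → ∀ z : K, IsSeparable k z := by
    intro h z
    have h1 : IntermediateField.adjoin k (ι '' S) ≤ separableClosure k K := by
      rw [IntermediateField.adjoin_le_iff]
      rintro _ ⟨x, hx, rfl⟩
      exact mem_separableClosure_iff.mpr ((hgen x hx).2.2 h)
    exact mem_separableClosure_iff.mp (h1 (htop ▸ IntermediateField.mem_top))
  -- automorphisms of `K` preserve `L`
  have hpres : ∀ (σ : K ≃ₐ[k] K) (x : L), ∃ y : L, ι y = σ (ι x) := by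
    intro σ x
    have hx : x ∈ Algebra.adjoin A S := hS ▸ Algebra.mem_top
    induction hx using Algebra.adjoin_induction with
    | mem x hx =>
      obtain ⟨s, hxs, -, p, hp⟩ := hgood x hx
      have hP := hmapK p s hp
      have hroot : aeval (ι x) (p.map (algebraMap A k)) = 0 := by
        rw [aeval_def, eval₂_eq_eval_map, hP, eval_multiset_prod]
        refine Multiset.prod_eq_zero ?_
        simp only [Multiset.map_map, Multiset.mem_map]
        exact ⟨x, hxs, by simp⟩
      have hroot' : aeval (σ (ι x)) (p.map (algebraMap A k)) = 0 := by
        rw [aeval_algHom_apply, hroot, map_zero]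
      rw [aeval_def, eval₂_eq_eval_map, hP, eval_multiset_prod, Multiset.prod_eq_zero_iff] at hroot'
      simp only [Multiset.map_map, Multiset.mem_map] at hroot'
      obtain ⟨a, _, ha⟩ := hroot'
      refine ⟨a, ?_⟩
      simp only [Function.comp_apply, eval_sub, eval_X, eval_C] at ha
      exact (sub_eq_zero.mp ha).symm
    | algebraMap a => exact ⟨algebraMap A L a, by rw [← hcomp', AlgEquiv.commutes]⟩
    | add x y _ _ hx hy =>
      obtain ⟨x', hx'⟩ := hx
      obtain ⟨y', hy'⟩ := hy
      exact ⟨x' + y', by simp [hx', hy']⟩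
    | mul x y _ _ hx hy =>
      obtain ⟨x', hx'⟩ := hx
      obtain ⟨y', hy'⟩ := hy
      exact ⟨x' * y', by simp [hx', hy']⟩
  have hrestr : ∀ σ : K ≃ₐ[k] K, ∃ τ : L ≃ₐ[A] L, ∀ x, ι (τ x) = σ (ι x) := by
    intro σ
    choose f hf using hpres σ
    choose g hg using hpres σ.symm
    refine ⟨{ toFun := f, invFun := g, left_inv := fun x => hι ?_, right_inv := fun x => hι ?_,
              map_mul' := fun x y => hι ?_, map_add' := fun x y => hι ?_,
              commutes' := fun a => hι ?_ }, hf⟩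
    · rw [hg, hf, AlgEquiv.symm_apply_apply]
    · rw [hf, hg, AlgEquiv.apply_symm_apply]
    · simp [hf]
    · simp [hf]
    · rw [hf, ← hcomp', AlgEquiv.commutes]
  -- the conjugates
  set μ := minpoly k (ι c) with hμ
  have hμm : μ.Monic := minpoly.monic (h_int.isIntegral _)
  have hμs : (μ.map (algebraMap k K)).Splits := hnormal.splits _
  have hroots : ∀ r ∈ (μ.map (algebraMap k K)).roots,
      ∃ τ : L ≃ₐ[A] L, ι (τ c) = r := by
    intro r hr
    have hr0 : aeval r μ = 0 := by
      rw [mem_roots (hμm.map _).ne_zero, IsRoot.def, ← eval₂_eq_eval_map] at hr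
      exact hr
    obtain ⟨σ, hσ⟩ := minpoly.exists_algEquiv_of_root'
      (h_int.isIntegral (ι c)).isAlgebraic hr0
    obtain ⟨τ, hτ⟩ := hrestr σ
    exact ⟨τ, by rw [hτ, hσ]⟩
  let s : Multiset L := (μ.map (algebraMap k K)).roots.map (Function.invFun ι)
  have hinv : ∀ r ∈ (μ.map (algebraMap k K)).roots, ι (Function.invFun ι r) = r := by
    intro r hr
    obtain ⟨τ, hτ⟩ := hroots r hr
    exact Function.invFun_eq ⟨_, hτ⟩
  have hsι : s.map ι = (μ.map (algebraMap k K)).roots := by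
    simp only [s, Multiset.map_map]
    conv_rhs => rw [← Multiset.map_id (μ.map (algebraMap k K)).roots]
    exact Multiset.map_congr rfl fun r hr => hinv r hr
  clear_value s
  have hprod : ((s.map fun a => X - C a).prod).map ι = μ.map (algebraMap k K) := by
    rw [hμs.eq_prod_roots_of_monic (hμm.map _), ← hsι, Polynomial.map_multiset_prod,
      Multiset.map_map, Multiset.map_map]
    simp
  have hlift : ((s.map fun a => X - C a).prod) ∈ lifts (algebraMap A L) := by
    rw [lifts_iff_coeff_lifts]
    intro n
    have h1 : ι (((s.map fun a => X - C a).prod).coeff n) = algebraMap k K (μ.coeff n) := by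
      rw [← coeff_map, hprod, coeff_map]
    obtain ⟨a, b, hb, hab⟩ := IsFractionRing.div_surjective (A := A) (μ.coeff n)
    have hb0 : b ≠ 0 := nonZeroDivisors.ne_zero hb
    refine hsat b hb0 _ ⟨a, hι ?_⟩
    rw [map_mul, h1, ← hab, ← hcomp', ← hcomp', ← map_mul]
    congr 1
    have : algebraMap A k b ≠ 0 := by
      rwa [Ne, map_eq_zero_iff _ hAk]
    exact (mul_div_cancel₀ _ this).symm
  obtain ⟨p, hp⟩ := hlift
  have hp' : p.map (algebraMap A L) = (s.map fun a => X - C a).prod := hp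
  have hpμ : p.map (algebraMap A k) = μ := by
    apply Polynomial.map_injective _ (algebraMap k K).injective
    rw [Polynomial.map_map, hcomp, ← Polynomial.map_map, hp', hprod]
  refine ⟨s, ?_, ?_, ?_, p, hp', ?_⟩
  · have h1 : ι c ∈ s.map ι := by
      rw [hsι, mem_roots (hμm.map _).ne_zero, IsRoot.def, ← eval₂_eq_eval_map]
      exact minpoly.aeval k (ι c)
    exact (Multiset.mem_map_of_injective hι).mp h1
  · intro h
    refine Multiset.Nodup.of_map ι ?_
    rw [hsι]
    exact nodup_roots (Separable.map (hsepK h (ι c)))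
  · intro a ha
    have h1 : ι a ∈ (μ.map (algebraMap k K)).roots := by
      rw [← hsι]
      exact Multiset.mem_map_of_mem _ ha
    obtain ⟨τ, hτ⟩ := hroots _ h1
    exact ⟨τ, hι hτ⟩
  · intro q hq hq0 hdeg
    apply Polynomial.map_injective _ hAk
    have h0 : aeval (ι c) (q.map (algebraMap A k)) = 0 := by
      rw [aeval_def, eval₂_map, hcomp, ← hom_eval₂, ← aeval_def, hq0, map_zero]
    rw [hpμ]
    refine (eq_of_monic_of_dvd_of_natDegree_le hμm (hq.map _) (minpoly.dvd k _ h0) ?_)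
    rw [← hpμ, natDegree_map_eq_of_injective hAk, natDegree_map_eq_of_injective hAk]
    exact natDegree_le_natDegree hdeg

/-- If a domain `L` is generated over `A` by elements each of which is a root of a polynomial over
`A` splitting over `L`, then every element of `L` has its full set of conjugates in `L`. -/
theorem exists_conjugates_of_closure {A L : Type*} [CommRing A] [CommRing L] [IsDomain L]
    [Algebra A L]
    [FaithfulSMul A L] (sep : Prop)
    (hsat : ∀ a : A, a ≠ 0 → ∀ x : L, algebraMap A L a * x ∈ (algebraMap A L).range →
      x ∈ (algebraMap A L).range)
    (S : Set L)
    (hS : ∀ K : Subring L, (∀ a : A, algebraMap A L a ∈ K) → S ⊆ K → ∀ x, x ∈ K)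
    (hgood : ∀ c ∈ S, ∃ s : Multiset L, c ∈ s ∧ (sep → s.Nodup) ∧
      ∃ p : A[X], p.map (algebraMap A L) = (s.map fun a => X - C a).prod) (c : L) :
    ∃ s : Multiset L, c ∈ s ∧ (sep → s.Nodup) ∧ (∀ a ∈ s, ∃ σ : L ≃ₐ[A] L, σ c = a) ∧
      ∃ p : A[X], p.map (algebraMap A L) = (s.map fun a => X - C a).prod ∧
        ∀ q : A[X], q.Monic → aeval c q = 0 → q.degree ≤ p.degree → q = p := by
  have htop : Algebra.adjoin A S = ⊤ := by
    rw [eq_top_iff]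
    exact fun x _ => hS (Algebra.adjoin A S).toSubring (Algebra.adjoin A S).algebraMap_mem
      Algebra.subset_adjoin x
  have hAL : Function.Injective (algebraMap A L) := FaithfulSMul.algebraMap_injective A L
  have : IsDomain A := IsDomain.of_faithfulSMul A L
  have : FaithfulSMul A (FractionRing L) := by
    rw [faithfulSMul_iff_algebraMap_injective, IsScalarTower.algebraMap_eq A L (FractionRing L)]
    exact (IsFractionRing.injective L (FractionRing L)).comp hAL
  let : Algebra (FractionRing A) (FractionRing L) := FractionRing.liftAlgebra A (FractionRing L)
  refine exists_conjugates_of_isFractionRing (k := FractionRing A) (K := FractionRing L) hAL ?_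
    sep hsat S htop hgood c
  rw [← IsScalarTower.algebraMap_eq A (FractionRing A) (FractionRing L),
    ← IsScalarTower.algebraMap_eq A L (FractionRing L)]

end Conjugates

section Subrings

open Polynomial

variable {D : Type*} [Ring D]

/-- Every element of the list `l` is the image of `c ∈ L` under an automorphism of `L` over `A`. -/
def AreConjugates (A L : Subring D) (c : L) (l : List D) : Prop :=
  ∀ a ∈ l, ∃ σ : L ≃+* L, (∀ y : L, (y : D) ∈ A → σ y = y) ∧ (σ c : D) = a

/-- `c` is a root of a polynomial over `A` which is a product of linear factors over `L`,
pairwise distinct if `sep` holds. -/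
def IsSplitRoot (sep : Prop) (A L : Subring D) (c : D) : Prop :=
  ∃ l : List D, c ∈ l ∧ (∀ a ∈ l, a ∈ L) ∧ (sep → l.Nodup) ∧
    ∀ i, ((l.map fun a => X - C a).prod).coeff i ∈ A

theorem IsSplitRoot.mono {sep sep' : Prop} {A A' L L' : Subring D} {c : D}
    (h : IsSplitRoot sep A L c) (hs : sep' → sep) (hA : A ≤ A') (hL : L ≤ L') :
    IsSplitRoot sep' A' L' c := by
  obtain ⟨l, h1, h2, h3, h4⟩ := h
  exact ⟨l, h1, fun a ha => hL (h2 a ha), fun h => h3 (hs h), fun i => hA (h4 i)⟩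

theorem exists_list_of_forall_mem {L : Subring D} {l : List D} (h : ∀ a ∈ l, a ∈ L) :
    ∃ l' : List L, l'.map Subtype.val = l :=
  ⟨l.attach.map fun a => ⟨a.1, h a.1 a.2⟩, by simp [List.map_map, Function.comp_def]⟩

theorem map_subtype_prod_X_sub_C {L : Subring D} (l : List L) :
    ((l.map fun a => X - C a).prod).map L.subtype =
      ((l.map Subtype.val).map fun a => X - C a).prod := by
  rw [← coe_mapRingHom, map_list_prod, List.map_map, List.map_map]
  congr 2
  funext a
  simp

theorem exists_map_inclusion_eq {A L : Subring D} (h : A ≤ L) (p : L[X])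
    (hp : ∀ i, (p.coeff i : D) ∈ A) : ∃ q : A[X], q.map (Subring.inclusion h) = p := by
  have : p ∈ lifts (Subring.inclusion h) := by
    rw [lifts_iff_coeff_lifts]
    exact fun n => ⟨⟨_, hp n⟩, rfl⟩
  exact this

variable [IsDomain D]

theorem exists_conjugates_subring {A L : Subring D} (hAL : A ≤ L)
    (hcomm : ∀ x ∈ L, ∀ y ∈ L, x * y = y * x) (sep : Prop)
    (hsat : ∀ f ∈ A, f ≠ 0 → ∀ x ∈ L, f * x ∈ A → x ∈ A)
    (S : Set D) (hL : L = Subring.closure (A ∪ S))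
    (hS : ∀ c ∈ S, IsSplitRoot sep A L c) (c : L) :
    ∃ l : List L, c ∈ l ∧ (sep → l.Nodup) ∧ AreConjugates A L c (l.map Subtype.val) ∧
      ∃ p : A[X], p.map (Subring.inclusion hAL) = (l.map fun a => X - C a).prod ∧
        ∀ q : A[X], q.Monic → eval₂ A.subtype (c : D) q = 0 → q.degree ≤ p.degree → q = p := by
  let : CommRing A := { A.toRing with
    mul_comm := fun x y => Subtype.ext (hcomm x (hAL x.2) y (hAL y.2)) }
  let : CommRing L := { L.toRing with
    mul_comm := fun x y => Subtype.ext (hcomm x x.2 y y.2) }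
  let : Algebra A L := (Subring.inclusion hAL).toAlgebra
  have hmap : algebraMap A L = Subring.inclusion hAL := rfl
  have : FaithfulSMul A L := (faithfulSMul_iff_algebraMap_injective A L).mpr
    (Subring.inclusion_injective hAL)
  have hrange : ∀ x : L, x ∈ (algebraMap A L).range ↔ (x : D) ∈ A := by
    intro x
    constructor
    · rintro ⟨a, rfl⟩
      exact a.2
    · intro hx
      exact ⟨⟨x, hx⟩, rfl⟩
  have htop : ∀ K : Subring L, (∀ a : A, algebraMap A L a ∈ K) → ((↑) ⁻¹' S : Set L) ⊆ K →
      ∀ x, x ∈ K := by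
    rintro K hK1 hK2 ⟨x, hx⟩
    have h1 : L ≤ K.map L.subtype := by
      conv_lhs => rw [hL]
      rw [Subring.closure_le]
      rintro y (hy | hy)
      · exact ⟨⟨y, hAL hy⟩, hK1 ⟨y, hy⟩, rfl⟩
      · have hyL : y ∈ L := by
          rw [hL]
          exact Subring.subset_closure (Or.inr hy)
        exact ⟨⟨y, hyL⟩, hK2 hy, rfl⟩
    obtain ⟨z, hz, hzx⟩ := h1 hx
    have : z = ⟨x, hx⟩ := Subtype.ext hzx
    exact this ▸ hz
  obtain ⟨s, hcs, hs, hconj, p, hp, hmin⟩ := exists_conjugates_of_closure (A := A) (L := L) sep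
    (fun a ha x hx => by
      rw [hrange] at hx ⊢
      exact hsat a a.2 (fun h => ha (Subtype.ext h)) x x.2 hx)
    ((↑) ⁻¹' S : Set L) htop
    (fun x hx => by
      obtain ⟨l, h1, h2, h3, h4⟩ := hS x hx
      obtain ⟨l', rfl⟩ := exists_list_of_forall_mem h2
      refine ⟨(l' : Multiset L), ?_, ?_, ?_⟩
      · obtain ⟨y, hy, hyx⟩ := List.mem_map.mp h1
        have : y = x := Subtype.ext hyx
        exact Multiset.mem_coe.mpr (this ▸ hy)
      · intro h
        exact Multiset.coe_nodup.mpr ((h3 h).of_map _)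
      · rw [hmap, Multiset.map_coe, Multiset.prod_coe]
        refine exists_map_inclusion_eq hAL _ fun i => ?_
        have := h4 i
        rw [← map_subtype_prod_X_sub_C, coeff_map] at this
        exact this) c
  obtain ⟨l, rfl⟩ := Quot.exists_rep s
  change c ∈ (l : Multiset L) at hcs
  rw [Multiset.mem_coe] at hcs
  refine ⟨l, hcs, fun h => Multiset.coe_nodup.mp (hs h), ?_, p, ?_, ?_⟩
  · intro a ha
    obtain ⟨b, hb, rfl⟩ := List.mem_map.mp ha
    obtain ⟨σ, hσ⟩ := hconj b (Multiset.mem_coe.mpr hb)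
    refine ⟨σ.toRingEquiv, fun y hy => ?_, congrArg _ hσ⟩
    exact σ.commutes (⟨y, hy⟩ : A)
  · rw [← hmap, hp]
    exact Multiset.prod_coe _
  · intro q hq hq0
    refine hmin q hq ?_
    apply Subtype.ext
    have := hom_eval₂ q (Subring.inclusion hAL) L.subtype c
    exact this.trans hq0

variable {A L : Subring D} (hAL : A ≤ L) (hcomm : ∀ x ∈ L, ∀ y ∈ L, x * y = y * x)

include hAL hcomm

theorem exists_conjugates_list {sep : Prop}
    (hsat : ∀ f ∈ A, f ≠ 0 → ∀ x ∈ L, f * x ∈ A → x ∈ A)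
    (S : Set D) (hL : L = Subring.closure (A ∪ S))
    (hS : ∀ c ∈ S, IsSplitRoot sep A L c) (c : L) :
    ∃ l : List D, (c : D) ∈ l ∧ (sep → l.Nodup) ∧ AreConjugates A L c l ∧
      ∀ i, ((l.map fun a => X - C a).prod).coeff i ∈ A := by
  obtain ⟨l, h1, h2, h3, p, h4, -⟩ := exists_conjugates_subring hAL hcomm sep hsat S hL hS c
  refine ⟨l.map Subtype.val, List.mem_map_of_mem h1,
    fun h => (h2 h).map Subtype.val_injective, h3, fun i => ?_⟩
  rw [← map_subtype_prod_X_sub_C, ← h4, coeff_map, coeff_map]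
  exact (p.coeff i).2

theorem isGaloisExt_of_isSplitRoot
    (hsat : ∀ f ∈ A, f ≠ 0 → ∀ x ∈ L, f * x ∈ A → x ∈ A)
    (S : Set D) (hL : L = Subring.closure (A ∪ S))
    (hS : ∀ c ∈ S, IsSplitRoot True A L c) : IsGaloisExt A L := by
  refine ⟨hAL, fun x hx => ?_⟩
  obtain ⟨l, h1, h2, h3, h4⟩ := exists_conjugates_list hAL hcomm hsat S hL hS x
  have hl : ∀ a ∈ l, a = x := by
    intro a ha
    obtain ⟨σ, hσ, rfl⟩ := h3 a ha
    exact congrArg _ (hx σ hσ)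
  obtain rfl : l = [(x : D)] := by
    obtain ⟨n, hn⟩ : ∃ n, l = List.replicate n (x : D) := ⟨_, List.eq_replicate_of_mem hl⟩
    have hnd := h2 trivial
    rw [hn, List.nodup_replicate] at hnd
    rw [hn] at h1 ⊢
    interval_cases n
    · simp at h1
    · rfl
  have := h4 0
  simpa using this

theorem isNormalExt_of_isSplitRoot
    (hsat : ∀ f ∈ A, f ≠ 0 → ∀ x ∈ L, f * x ∈ A → x ∈ A)
    (S : Set D) (hL : L = Subring.closure (A ∪ S))
    (hS : ∀ c ∈ S, IsSplitRoot False A L c) : IsNormalExt A L := by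
  refine ⟨hAL, fun c hc q hq => ?_⟩
  obtain ⟨l, h1, -, -, p, h4, h5⟩ :=
    exists_conjugates_subring hAL hcomm False hsat S hL hS ⟨c, hc⟩
  have hpm : p.Monic := by
    refine monic_of_injective (Subring.inclusion_injective hAL) ?_
    rw [h4]
    let : CommRing L := { L.toRing with
      mul_comm := fun x y => Subtype.ext (hcomm x x.2 y y.2) }
    have := monic_multiset_prod_of_monic (l : Multiset L) (fun a => X - C a)
      fun a _ => monic_X_sub_C a
    rwa [Multiset.map_coe, Multiset.prod_coe] at this
  have hp0 : eval₂ A.subtype c p = 0 := by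
    have : eval₂ (Subring.inclusion hAL) (⟨c, hc⟩ : L) p = 0 := by
      rw [eval₂_eq_eval_map, h4]
      let : CommRing L := { L.toRing with
        mul_comm := fun x y => Subtype.ext (hcomm x x.2 y y.2) }
      refine (eval_list_prod _ _).trans (List.prod_eq_zero ?_)
      simp only [List.map_map, List.mem_map]
      exact ⟨_, h1, by simp⟩
    have h := hom_eval₂ p (Subring.inclusion hAL) L.subtype ⟨c, hc⟩
    rw [this, map_zero] at h
    exact h.symm
  exact ⟨l, by rw [h5 q hq.1 hq.2.1 (hq.2.2 p hpm hp0), h4]⟩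

theorem exists_conjugates_list_of_isGaloisExt (h : IsGaloisExt A L) (c : L)
    (hc : ∃ q : A[X], q.Monic ∧ eval₂ A.subtype (c : D) q = 0) :
    ∃ l : List D, (c : D) ∈ l ∧ l.Nodup ∧ AreConjugates A L c l ∧
      ∀ i, ((l.map fun a => X - C a).prod).coeff i ∈ A := by
  classical
  let : CommRing L := { L.toRing with
    mul_comm := fun x y => Subtype.ext (hcomm x x.2 y y.2) }
  obtain ⟨q, hq, hq0⟩ := hc
  let O : Set L := {b | ∃ σ : L ≃+* L, (∀ y : L, (y : D) ∈ A → σ y = y) ∧ σ c = b}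
  have hq0' : eval c (q.map (Subring.inclusion hAL)) = 0 := by
    rw [← eval₂_eq_eval_map]
    apply Subtype.ext
    exact (hom_eval₂ q (Subring.inclusion hAL) L.subtype c).trans hq0
  have hO : O.Finite := by
    refine ((q.map (Subring.inclusion hAL)).roots.toFinset.finite_toSet).subset ?_
    rintro b ⟨σ, hσ, rfl⟩
    simp only [Finset.mem_coe, Multiset.mem_toFinset]
    rw [mem_roots (hq.map _).ne_zero, IsRoot.def]
    have h1 : (q.map (Subring.inclusion hAL)).map (σ : L →+* L) =
        q.map (Subring.inclusion hAL) := by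
      ext i
      rw [coeff_map, coeff_map]
      exact congrArg _ (hσ _ (q.coeff i).2)
    rw [← h1, eval_map]
    have h2 := hom_eval₂ (q.map (Subring.inclusion hAL)) (RingHom.id L) (σ : L →+* L) c
    rw [RingHom.comp_id, ← eval, hq0', map_zero] at h2
    exact h2.symm
  set s := hO.toFinset with hs
  have hmem : ∀ b, b ∈ s ↔ b ∈ O := fun b => hO.mem_toFinset
  have hsT : ∀ τ : L ≃+* L, (∀ y : L, (y : D) ∈ A → τ y = y) → s.image τ = s := by
    intro τ hτ
    refine Finset.eq_of_subset_of_card_le ?_ (Finset.card_image_of_injective _ τ.injective).ge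
    intro b hb
    obtain ⟨a, ha, rfl⟩ := Finset.mem_image.mp hb
    obtain ⟨σ, hσ, rfl⟩ := (hmem a).mp ha
    exact (hmem _).mpr ⟨σ.trans τ, fun y hy => by
      rw [RingEquiv.trans_apply, hσ y hy, hτ y hy], rfl⟩
  have hfix : ∀ i, (((s.toList.map fun a => X - C a).prod).coeff i : D) ∈ A := by
    intro i
    refine h.2 _ fun τ hτ => ?_
    rw [Finset.prod_map_toList]
    have h1 : (∏ a ∈ s, (X - C a : L[X])).map (τ : L →+* L) = ∏ a ∈ s, (X - C a) := by
      conv_rhs => rw [← hsT τ hτ, Finset.prod_image τ.injective.injOn]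
      rw [Polynomial.map_prod]
      simp
    conv_rhs => rw [← h1, coeff_map]
    rfl
  refine ⟨s.toList.map Subtype.val, List.mem_map_of_mem ?_,
    s.nodup_toList.map Subtype.val_injective, ?_, fun i => ?_⟩
  · rw [Finset.mem_toList, hmem]
    exact ⟨RingEquiv.refl L, fun _ _ => rfl, rfl⟩
  · intro a ha
    obtain ⟨b, hb, rfl⟩ := List.mem_map.mp ha
    rw [Finset.mem_toList, hmem] at hb
    obtain ⟨σ, hσ, rfl⟩ := hb
    exact ⟨σ, hσ, rfl⟩
  · rw [← map_subtype_prod_X_sub_C, coeff_map]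
    exact hfix i

theorem isSplitRoot_of_splitsIn (c : L)
    (hc : ∃ q : A[X], q.Monic ∧ eval₂ A.subtype (c : D) q = 0)
    (h : ∀ p : A[X], IsMinPolyOf A (c : D) p → SplitsIn hAL p) : IsSplitRoot False A L c := by
  classical
  have hex : ∃ n : ℕ, ∃ q : A[X], q.Monic ∧ eval₂ A.subtype (c : D) q = 0 ∧ q.natDegree = n :=
    let ⟨q, h1, h2⟩ := hc; ⟨_, q, h1, h2, rfl⟩
  obtain ⟨p, hp, hp0, hpn⟩ := Nat.find_spec hex
  obtain ⟨l, hl⟩ := h p ⟨hp, hp0, fun q hq hq0 => by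
    have h1 := Nat.find_min' hex ⟨q, hq, hq0, rfl⟩
    rw [← hpn] at h1
    rwa [degree_eq_natDegree hp.ne_zero, degree_eq_natDegree hq.ne_zero, Nat.cast_le]⟩
  let : CommRing L := { L.toRing with
    mul_comm := fun x y => Subtype.ext (hcomm x x.2 y y.2) }
  refine ⟨l.map Subtype.val, List.mem_map_of_mem ?_, ?_, fun h => h.elim, fun i => ?_⟩
  · have h1 : eval c (p.map (Subring.inclusion hAL)) = 0 := by
      rw [← eval₂_eq_eval_map]
      apply Subtype.ext
      exact (hom_eval₂ p (Subring.inclusion hAL) L.subtype c).trans hp0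
    rw [hl] at h1
    have h2 := (eval_list_prod (l.map fun a => X - C a) c).symm.trans h1
    rw [List.prod_eq_zero_iff, List.map_map, List.mem_map] at h2
    obtain ⟨a, ha, hac⟩ := h2
    have : c = a := by simpa [sub_eq_zero] using hac
    exact this ▸ ha
  · intro a ha
    obtain ⟨b, -, rfl⟩ := List.mem_map.mp ha
    exact b.2
  · rw [← map_subtype_prod_X_sub_C, ← hl, coeff_map, coeff_map]
    exact (p.coeff i).2

end Subrings

section Grading

open DirectSum

variable {Γ : Type*} [AddCommGroup Γ]

theorem TorsionFree.twoUniqueSums (hΓ : TorsionFree Γ) : TwoUniqueSums Γ := by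
  have : IsAddTorsionFree Γ := by
    refine ⟨fun n hn a b hab => ?_⟩
    have h1 : n • (a - b) = 0 := by
      rw [nsmul_sub]
      exact sub_eq_zero.mpr hab
    exact sub_eq_zero.mp (hΓ _ n hn h1)
  exact TwoUniqueSums.of_injective_addHom (DivisibleHull.coeAddMonoidHom Γ).toAddHom
    DivisibleHull.coe_injective inferInstance

variable [DecidableEq Γ] {D : Type*} [Ring D] (𝒜 : Γ → AddSubgroup D) [GradedRing 𝒜]

theorem proj_mem (γ : Γ) (x : D) : GradedRing.proj 𝒜 γ x ∈ 𝒜 γ :=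
  SetLike.coe_mem _

theorem proj_of_mem {γ : Γ} {x : D} (hx : x ∈ 𝒜 γ) : GradedRing.proj 𝒜 γ x = x :=
  decompose_of_mem_same 𝒜 hx

theorem proj_of_mem_ne {γ δ : Γ} {x : D} (hx : x ∈ 𝒜 γ) (h : γ ≠ δ) :
    GradedRing.proj 𝒜 δ x = 0 :=
  decompose_of_mem_ne 𝒜 hx h

theorem proj_mul_right {δ : Γ} {s : D} (hs : s ∈ 𝒜 δ) (γ : Γ) (x : D) :
    GradedRing.proj 𝒜 γ (x * s) = GradedRing.proj 𝒜 (γ - δ) x * s := by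
  have := coe_decompose_mul_add_of_right_mem 𝒜 (i := γ - δ) (a := x) hs
  rwa [sub_add_cancel] at this

theorem proj_mul_left {δ : Γ} {s : D} (hs : s ∈ 𝒜 δ) (γ : Γ) (x : D) :
    GradedRing.proj 𝒜 γ (s * x) = s * GradedRing.proj 𝒜 (γ - δ) x := by
  have := coe_decompose_mul_add_of_left_mem 𝒜 (j := γ - δ) (b := x) hs
  rwa [add_sub_cancel] at this

theorem mem_of_forall_proj_mem {S : Type*} [SetLike S D] [AddSubmonoidClass S D] {E : S} {x : D}
    (h : ∀ γ, GradedRing.proj 𝒜 γ x ∈ E) : x ∈ E := by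
  classical
  rw [← sum_support_decompose 𝒜 x]
  exact sum_mem fun γ _ => h γ

theorem exists_proj_ne_zero {x : D} (hx : x ≠ 0) : ∃ γ, GradedRing.proj 𝒜 γ x ≠ 0 := by
  by_contra! h
  exact hx (mem_of_forall_proj_mem 𝒜 (E := (⊥ : AddSubgroup D)) fun γ => h γ)

theorem proj_mem_centralizer {S : Set D} (hS : ∀ s ∈ S, SetLike.IsHomogeneousElem 𝒜 s) {x : D}
    (hx : ∀ s ∈ S, s * x = x * s) (γ : Γ) (s : D) (hs : s ∈ S) :
    s * GradedRing.proj 𝒜 γ x = GradedRing.proj 𝒜 γ x * s := by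
  obtain ⟨δ, hδ⟩ := hS s hs
  have h1 := congrArg (GradedRing.proj 𝒜 (γ + δ)) (hx s hs)
  rwa [proj_mul_left 𝒜 hδ, proj_mul_right 𝒜 hδ, add_sub_cancel_right] at h1

theorem commute_of_forall_homogeneous {x : D}
    (h : ∀ s, SetLike.IsHomogeneousElem 𝒜 s → s * x = x * s) (y : D) : y * x = x * y := by
  have : y ∈ Subring.centralizer {x} := mem_of_forall_proj_mem 𝒜 fun γ => by
    rw [Subring.mem_centralizer_iff]
    rintro _ rfl
    exact (h _ ⟨γ, proj_mem 𝒜 γ y⟩).symm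
  exact (Subring.mem_centralizer_iff.mp this x rfl).symm

theorem proj_mem_center {x : D} (hx : x ∈ Subring.center D) (γ : Γ) :
    GradedRing.proj 𝒜 γ x ∈ Subring.center D := by
  rw [Subring.mem_center_iff] at hx ⊢
  exact commute_of_forall_homogeneous 𝒜 fun s hs =>
    proj_mem_centralizer 𝒜 (S := {s}) (by rintro _ rfl; exact hs) (fun t _ => hx t) γ s rfl

theorem isGradedSubring_closure {S : Set D} (hS : ∀ s ∈ S, ∀ γ, GradedRing.proj 𝒜 γ s ∈
    Subring.closure S) : IsGradedSubring 𝒜 (Subring.closure S) := by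
  classical
  intro x hx
  change ∀ γ, GradedRing.proj 𝒜 γ x ∈ _
  induction hx using Subring.closure_induction with
  | mem x hx => exact hS x hx
  | zero => exact fun γ => by rw [map_zero]; exact zero_mem _
  | one =>
    intro γ
    by_cases h : (0 : Γ) = γ
    · subst h
      rw [proj_of_mem 𝒜 SetLike.GradedOne.one_mem]
      exact one_mem _
    · rw [proj_of_mem_ne 𝒜 SetLike.GradedOne.one_mem h]
      exact zero_mem _
  | add x y _ _ hx hy => exact fun γ => by rw [map_add]; exact add_mem (hx γ) (hy γ)
  | neg x _ hx => exact fun γ => by rw [map_neg]; exact neg_mem (hx γ)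
  | mul x y _ _ hx hy =>
    intro γ
    rw [GradedRing.proj_apply, decompose_mul, coe_mul_apply]
    exact sum_mem fun ij _ => mul_mem (hx _) (hy _)

theorem proj_mul_of_uniqueAdd {x y : D} {A B : Finset Γ} {a b : Γ}
    (hA : ∀ γ, GradedRing.proj 𝒜 γ x ≠ 0 → γ ∈ A) (hB : ∀ γ, GradedRing.proj 𝒜 γ y ≠ 0 → γ ∈ B)
    (h : UniqueAdd A B a b) :
    GradedRing.proj 𝒜 (a + b) (x * y) = GradedRing.proj 𝒜 a x * GradedRing.proj 𝒜 b y := by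
  classical
  rw [GradedRing.proj_apply, decompose_mul, coe_mul_apply]
  change ∑ ij ∈ Finset.filter (fun ij : Γ × Γ => _) _, GradedRing.proj 𝒜 ij.1 x * GradedRing.proj 𝒜 ij.2 y = _
  rw [Finset.sum_eq_single (a, b)]
  · rintro ⟨i, j⟩ hij hne
    by_contra h0
    rw [Finset.mem_filter] at hij
    obtain ⟨h1, h2⟩ := h (hA i (left_ne_zero_of_mul h0)) (hB j (right_ne_zero_of_mul h0)) hij.2
    exact hne (Prod.ext h1 h2)
  · intro hab
    by_contra h0
    refine hab (Finset.mem_filter.mpr ⟨Finset.mem_product.mpr ⟨?_, ?_⟩, rfl⟩)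
    · rw [DFinsupp.mem_support_iff]
      exact fun h => left_ne_zero_of_mul h0 (congrArg Subtype.val h)
    · rw [DFinsupp.mem_support_iff]
      exact fun h => right_ne_zero_of_mul h0 (congrArg Subtype.val h)

theorem exists_support (x : D) : ∃ A : Finset Γ, ∀ γ, GradedRing.proj 𝒜 γ x ≠ 0 ↔ γ ∈ A := by
  classical
  refine ⟨(decompose 𝒜 x).support, fun γ => ?_⟩
  rw [DFinsupp.mem_support_iff, GradedRing.proj_apply, Ne, Ne, ZeroMemClass.coe_eq_zero]

variable {𝒜}

theorem IsGradedDivisionRing.mul_ne_zero (hD : IsGradedDivisionRing 𝒜) {γ : Γ} {x y : D}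
    (hx : x ∈ 𝒜 γ) (hx0 : x ≠ 0) (hy : y ≠ 0) : x * y ≠ 0 := by
  intro h
  exact hy ((hD.2 γ x hx hx0).mul_right_eq_zero.mp h)

theorem IsGradedDivisionRing.isDomain (hD : IsGradedDivisionRing 𝒜) (hΓ : TorsionFree Γ) :
    IsDomain D := by
  have := hΓ.twoUniqueSums
  have : Nontrivial D := ⟨0, 1, hD.1⟩
  have : NoZeroDivisors D := by
    refine ⟨fun {x y} hxy => ?_⟩
    by_contra! h
    obtain ⟨A, hA⟩ := exists_support 𝒜 x
    obtain ⟨B, hB⟩ := exists_support 𝒜 y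
    obtain ⟨a', ha'⟩ := exists_proj_ne_zero 𝒜 h.1
    obtain ⟨b', hb'⟩ := exists_proj_ne_zero 𝒜 h.2
    obtain ⟨a, ha, b, hb, hab⟩ := UniqueSums.uniqueAdd_of_nonempty (A := A) (B := B)
      ⟨a', (hA _).mp ha'⟩ ⟨b', (hB _).mp hb'⟩
    refine hD.mul_ne_zero (proj_mem 𝒜 a x) ((hA a).mpr ha) ((hB b).mpr hb) ?_
    rw [← proj_mul_of_uniqueAdd 𝒜 (fun γ => (hA γ).mp) (fun γ => (hB γ).mp) hab, hxy, map_zero]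
  exact NoZeroDivisors.to_isDomain D

theorem IsGradedDivisionRing.isHomogeneousElem_of_mul_eq_one (hD : IsGradedDivisionRing 𝒜)
    (hΓ : TorsionFree Γ) {x y : D} (hxy : x * y = 1) : SetLike.IsHomogeneousElem 𝒜 x := by
  have := hΓ.twoUniqueSums
  have := hD.isDomain hΓ
  have hx0 : x ≠ 0 := left_ne_zero_of_mul_eq_one hxy
  have hy0 : y ≠ 0 := right_ne_zero_of_mul_eq_one hxy
  obtain ⟨A, hA⟩ := exists_support 𝒜 x
  obtain ⟨B, hB⟩ := exists_support 𝒜 y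
  obtain ⟨a, ha⟩ := exists_proj_ne_zero 𝒜 hx0
  obtain ⟨b, hb⟩ := exists_proj_ne_zero 𝒜 hy0
  have haA := (hA _).mp ha
  have hbB := (hB _).mp hb
  have hcard : A.card * B.card ≤ 1 := by
    by_contra! h
    obtain ⟨p, hp, q, hq, hpq, h1, h2⟩ := TwoUniqueSums.uniqueAdd_of_one_lt_card h
    rw [Finset.mem_product] at hp hq
    have key : ∀ r : Γ × Γ, r.1 ∈ A → r.2 ∈ B → UniqueAdd A B r.1 r.2 → r.1 + r.2 = 0 := by
      intro r hr1 hr2 hr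
      by_contra hne
      have h3 := proj_mul_of_uniqueAdd 𝒜 (fun γ => (hA γ).mp) (fun γ => (hB γ).mp) hr
      rw [hxy, proj_of_mem_ne 𝒜 SetLike.GradedOne.one_mem (Ne.symm hne)] at h3
      exact _root_.mul_ne_zero ((hA _).mpr hr1) ((hB _).mpr hr2) h3.symm
    obtain ⟨h4, h5⟩ := h1 hq.1 hq.2 ((key q hq.1 hq.2 h2).trans (key p hp.1 hp.2 h1).symm)
    exact hpq (Prod.ext h4.symm h5.symm)
  have hA1 : A.card ≤ 1 := by
    have : 1 ≤ B.card := Finset.card_pos.mpr ⟨b, hbB⟩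
    nlinarith
  refine ⟨a, mem_of_forall_proj_mem 𝒜 fun γ => ?_⟩
  by_cases h : GradedRing.proj 𝒜 γ x = 0
  · rw [h]
    exact zero_mem _
  · rw [Finset.card_le_one.mp hA1 a haA γ ((hA γ).mp h)]
    exact proj_mem 𝒜 γ x

theorem IsGradedDivisionRing.mem_neg_of_mul_eq_one (hD : IsGradedDivisionRing 𝒜) {γ : Γ}
    {x y : D} (hx : x ∈ 𝒜 γ) (hxy : x * y = 1) : y ∈ 𝒜 (-γ) := by
  have hx0 : x ≠ 0 := by
    rintro rfl
    exact hD.1 (by rw [← hxy, zero_mul])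
  have h1 : x * GradedRing.proj 𝒜 (-γ) y = 1 := by
    have := proj_mul_left 𝒜 hx 0 y
    rw [hxy, proj_of_mem 𝒜 SetLike.GradedOne.one_mem, zero_sub] at this
    exact this.symm
  rw [← (hD.2 γ x hx hx0).mul_left_cancel (h1.trans hxy.symm)]
  exact proj_mem 𝒜 _ _

/-- Nonzero homogeneous elements have a two-sided homogeneous inverse. -/
theorem IsGradedDivisionRing.exists_inv (hD : IsGradedDivisionRing 𝒜) {γ : Γ}
    {x : D} (hx : x ∈ 𝒜 γ) (hx0 : x ≠ 0) : ∃ y ∈ 𝒜 (-γ), x * y = 1 ∧ y * x = 1 := by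
  obtain ⟨u, rfl⟩ := hD.2 γ x hx hx0
  exact ⟨_, hD.mem_neg_of_mul_eq_one hx u.mul_inv, u.mul_inv, u.inv_mul⟩

end Grading

section Finiteness

open Polynomial

variable {Γ : Type*} [AddCommGroup Γ] [DecidableEq Γ] {D : Type*} [Ring D]

theorem exists_monic_center [Module.Finite (Subring.center D) D] (x : D) :
    ∃ q : (Subring.center D)[X], q.Monic ∧ eval₂ (Subring.center D).subtype x q = 0 :=
  IsIntegral.of_finite (Subring.center D) x

/-- A subring contains the inverses of its elements that are integral over it. -/
theorem mem_of_mul_eq_one_of_monic {A B : Subring D} (hAB : A ≤ B) {y z : D} (hy : y ∈ B)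
    (hyz : y * z = 1) (hzy : z * y = 1) {q : A[X]} (hq : q.Monic)
    (hq0 : eval₂ A.subtype z q = 0) : z ∈ B := by
  rw [eval₂_eq_sum_range, Finset.sum_range_succ, hq.coeff_natDegree, map_one, one_mul] at hq0
  rcases hn : q.natDegree with _ | m
  · rw [hn] at hq0
    simp only [Finset.range_zero, Finset.sum_empty, pow_zero, zero_add] at hq0
    have : z = 0 := by rw [← one_mul z, hq0, zero_mul]
    exact this ▸ B.zero_mem
  rw [hn] at hq0
  have hpow : ∀ n : ℕ, z ^ n * y ^ n = 1 := fun n => by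
    rw [← Commute.mul_pow (hzy.trans hyz.symm), hzy, one_pow]
  have h1 := congrArg (· * y ^ m) hq0
  simp only [add_mul, zero_mul, Finset.sum_mul] at h1
  rw [pow_succ', mul_assoc, hpow, mul_one] at h1
  have h2 : z = -∑ i ∈ Finset.range (m + 1), A.subtype (q.coeff i) * z ^ i * y ^ m :=
    eq_neg_of_add_eq_zero_right h1
  rw [h2]
  refine neg_mem (sum_mem fun i hi => ?_)
  have him : i ≤ m := Nat.lt_succ_iff.mp (Finset.mem_range.mp hi)
  have : z ^ i * y ^ m = y ^ (m - i) := by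
    conv_lhs => rw [← Nat.add_sub_cancel' him, pow_add, ← mul_assoc, hpow, one_mul]
  rw [mul_assoc, this]
  exact mul_mem (hAB (q.coeff i).2) (pow_mem hy _)

theorem mem_of_mul_eq_one [Module.Finite (Subring.center D) D] {B : Subring D}
    (hB : Subring.center D ≤ B) {y z : D} (hy : y ∈ B)
    (hyz : y * z = 1) (hzy : z * y = 1) : z ∈ B := by
  obtain ⟨q, hq, hq0⟩ := exists_monic_center z
  exact mem_of_mul_eq_one_of_monic hB hy hyz hzy hq hq0

variable (𝒜 : Γ → AddSubgroup D) [GradedRing 𝒜]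

/-- A homogeneous element of degree `γ` is annihilated by a monic expression whose coefficients
are central and homogeneous, of complementary degrees. -/
theorem exists_homogeneous_monic [Module.Finite (Subring.center D) D] {γ : Γ} {x : D}
    (hx : x ∈ 𝒜 γ) : ∃ (n : ℕ) (g : ℕ → D), (∀ i, g i ∈ Subring.center D) ∧
      (∀ i ≤ n, g i ∈ 𝒜 (n • γ - i • γ)) ∧ ∑ i ∈ Finset.range n, g i * x ^ i + x ^ n = 0 := by
  obtain ⟨q, hq, hq0⟩ := exists_monic_center x
  refine ⟨q.natDegree, fun i => GradedRing.proj 𝒜 (q.natDegree • γ - i • γ) (q.coeff i),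
    fun i => proj_mem_center 𝒜 (q.coeff i).2 _, fun i _ => proj_mem 𝒜 _ _, ?_⟩
  rw [eval₂_eq_sum_range, Finset.sum_range_succ, hq.coeff_natDegree, map_one, one_mul] at hq0
  have h1 := congrArg (GradedRing.proj 𝒜 (q.natDegree • γ)) hq0
  rw [map_add, map_zero, map_sum, proj_of_mem 𝒜 (SetLike.pow_mem_graded _ hx)] at h1
  rw [← h1]
  congr 1
  refine Finset.sum_congr rfl fun i _ => ?_
  rw [proj_mul_right 𝒜 (SetLike.pow_mem_graded i hx)]
  rfl

theorem exists_monic_grade0 [Module.Finite (Subring.center D) D] {x : D} (hx : x ∈ grade0 𝒜) :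
    ∃ q : (↥(Subring.center D ⊓ grade0 𝒜))[X], q.Monic ∧
      eval₂ (Subring.center D ⊓ grade0 𝒜).subtype x q = 0 := by
  have hx' : x ∈ 𝒜 0 := hx
  obtain ⟨n, g, hg, hg', h⟩ := exists_homogeneous_monic 𝒜 hx'
  simp only [smul_zero, sub_zero] at hg'
  classical
  let g' : ℕ → ↥(Subring.center D ⊓ grade0 𝒜) := fun i =>
    if hi : i ≤ n then ⟨g i, hg i, hg' i hi⟩ else 0
  refine ⟨X ^ n + ∑ i ∈ Finset.range n, C (g' i) * X ^ i, ?_, ?_⟩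
  · by_cases hS : Nontrivial ↥(Subring.center D ⊓ grade0 𝒜)
    · refine monic_X_pow_add ?_
      refine (degree_sum_le _ _).trans_lt ?_
      rw [Finset.sup_lt_iff (by exact_mod_cast WithBot.bot_lt_coe n)]
      intro i hi
      exact (degree_C_mul_X_pow_le i _).trans_lt (by exact_mod_cast Finset.mem_range.mp hi)
    · rw [not_nontrivial_iff_subsingleton] at hS
      exact Subsingleton.elim _ _
  · rw [eval₂_add, eval₂_X_pow, eval₂_finsetSum, add_comm, ← h]
    congr 1
    refine Finset.sum_congr rfl fun i hi => ?_
    rw [C_mul_X_pow_eq_monomial, eval₂_monomial]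
    have hi' : i ≤ n := (Finset.mem_range.mp hi).le
    simp only [g', dif_pos hi']
    rfl

theorem mem_of_mul_eq_one_grade0 [Module.Finite (Subring.center D) D] {B : Subring D}
    (hB : Subring.center D ⊓ grade0 𝒜 ≤ B) {y z : D} (hy : y ∈ B) (hz : z ∈ grade0 𝒜)
    (hyz : y * z = 1) (hzy : z * y = 1) : z ∈ B := by
  obtain ⟨q, hq, hq0⟩ := exists_monic_grade0 𝒜 hz
  exact mem_of_mul_eq_one_of_monic hB hy hyz hzy hq hq0

theorem exists_homogeneous_generators [Module.Finite (Subring.center D) D] :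
    ∃ W : Finset D, (∀ w ∈ W, SetLike.IsHomogeneousElem 𝒜 w) ∧
      ∀ x : D, ∃ f : D → D, (∀ w, f w ∈ Subring.center D) ∧ x = ∑ w ∈ W, f w * w := by
  classical
  obtain ⟨S, hS⟩ := Module.Finite.fg_top (R := Subring.center D) (M := D)
  choose A hA using exists_support 𝒜
  refine ⟨S.biUnion fun s => (A s).image fun γ => GradedRing.proj 𝒜 γ s, ?_, ?_⟩
  · intro w hw
    simp only [Finset.mem_biUnion, Finset.mem_image] at hw
    obtain ⟨s, -, γ, -, rfl⟩ := hw
    exact ⟨γ, proj_mem 𝒜 γ s⟩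
  · intro x
    have hx : x ∈ Submodule.span (Subring.center D)
        ((S.biUnion fun s => (A s).image fun γ => GradedRing.proj 𝒜 γ s : Finset D) : Set D) := by
      have hx : x ∈ Submodule.span (Subring.center D) (S : Set D) := hS ▸ Submodule.mem_top
      refine Submodule.span_le.mpr ?_ hx
      intro s hs
      refine mem_of_forall_proj_mem 𝒜 fun γ => ?_
      by_cases h : GradedRing.proj 𝒜 γ s = 0
      · rw [h]
        exact zero_mem _
      · refine Submodule.subset_span ?_
        simp only [Finset.mem_coe, Finset.mem_biUnion, Finset.mem_image]
        exact ⟨s, hs, γ, (hA s γ).mp h, rfl⟩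
    obtain ⟨f, -, hf⟩ := Submodule.mem_span_finset.mp hx
    exact ⟨fun w => f w, fun w => (f w).2, hf.symm⟩

/-- Up to degrees of nonzero central homogeneous elements there are only finitely many degrees. -/
theorem exists_finite_degrees [Module.Finite (Subring.center D) D] :
    ∃ W : Finset Γ, ∀ γ, ∀ d ∈ 𝒜 γ, d ≠ 0 →
      ∃ δ ∈ W, ∃ φ ∈ Subring.center D, φ ∈ 𝒜 (γ - δ) ∧ φ ≠ 0 := by
  classical
  obtain ⟨W, hW, hspan⟩ := exists_homogeneous_generators 𝒜
  choose! deg hdeg using hW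
  refine ⟨W.image deg, fun γ d hd hd0 => ?_⟩
  obtain ⟨f, hf, hsum⟩ := hspan d
  have h1 := congrArg (GradedRing.proj 𝒜 γ) hsum
  rw [proj_of_mem 𝒜 hd, map_sum] at h1
  obtain ⟨w, hw, hne⟩ := Finset.exists_ne_zero_of_sum_ne_zero (h1 ▸ hd0)
  rw [proj_mul_right 𝒜 (hdeg w hw)] at hne
  exact ⟨deg w, Finset.mem_image_of_mem _ hw, _, proj_mem_center 𝒜 (hf w) _, proj_mem 𝒜 _ _,
    left_ne_zero_of_mul hne⟩

variable {𝒜}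

theorem IsGradedDivisionRing.finite_grade0 [Module.Finite (Subring.center D) D]
    (hD : IsGradedDivisionRing 𝒜) :
    Module.Finite (Subring.center (grade0 𝒜)) (grade0 𝒜) := by
  classical
  obtain ⟨W, hW, hspan⟩ := exists_homogeneous_generators 𝒜
  have key : ∀ w ∈ W, ∃ e : grade0 𝒜, ∀ f ∈ Subring.center D,
      ∃ z : Subring.center (grade0 𝒜), GradedRing.proj 𝒜 0 (f * w) = ((z • e : grade0 𝒜) : D) := by
    intro w hw
    obtain ⟨δ, hδ⟩ := hW w hw
    by_cases h : ∃ φ ∈ Subring.center D, φ ∈ 𝒜 (-δ) ∧ φ ≠ 0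
    · obtain ⟨φ, hφc, hφ, hφ0⟩ := h
      obtain ⟨ψ, hψ, hφψ, hψφ⟩ := hD.exists_inv hφ hφ0
      have hψc : ψ ∈ Subring.center D := mem_of_mul_eq_one le_rfl hφc hφψ hψφ
      have he : φ * w ∈ 𝒜 0 := by
        have := SetLike.mul_mem_graded hφ hδ
        rwa [neg_add_cancel] at this
      refine ⟨⟨φ * w, he⟩, fun f hf => ?_⟩
      have hz : GradedRing.proj 𝒜 (-δ) f * ψ ∈ 𝒜 0 := by
        have := SetLike.mul_mem_graded (proj_mem 𝒜 (-δ) f) hψ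
        rwa [add_neg_cancel] at this
      have hzc : GradedRing.proj 𝒜 (-δ) f * ψ ∈ Subring.center D :=
        mul_mem (proj_mem_center 𝒜 hf _) hψc
      refine ⟨⟨⟨_, hz⟩, ?_⟩, ?_⟩
      · rw [Subring.mem_center_iff] at hzc ⊢
        exact fun g => Subtype.ext (hzc g)
      · rw [proj_mul_right 𝒜 hδ, zero_sub]
        change _ = GradedRing.proj 𝒜 (-δ) f * ψ * (φ * w)
        rw [mul_assoc, ← mul_assoc ψ, hψφ, one_mul]
    · refine ⟨0, fun f hf => ⟨0, ?_⟩⟩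
      rw [proj_mul_right 𝒜 hδ, zero_sub, smul_zero]
      by_contra h0
      exact h ⟨_, proj_mem_center 𝒜 hf _, proj_mem 𝒜 _ _, left_ne_zero_of_mul h0⟩
  choose! e he using key
  refine ⟨⟨W.image e, ?_⟩⟩
  rw [eq_top_iff]
  rintro ⟨x, hx⟩ -
  obtain ⟨f, hf, hsum⟩ := hspan x
  have h2 : ∀ w ∈ W, ∃ z : Subring.center (grade0 𝒜),
      GradedRing.proj 𝒜 0 (f w * w) = ((z • e w : grade0 𝒜) : D) := fun w hw =>
    he w hw (f w) (hf w)
  choose! z hz using h2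
  have h3 : (⟨x, hx⟩ : grade0 𝒜) = ∑ w ∈ W, z w • e w := by
    apply Subtype.ext
    rw [AddSubmonoidClass.coe_finsetSum]
    have h1 := congrArg (GradedRing.proj 𝒜 0) hsum
    rw [proj_of_mem 𝒜 hx, map_sum] at h1
    exact h1.trans (Finset.sum_congr rfl hz)
  rw [h3]
  refine sum_mem fun w hw => Submodule.smul_mem _ _ (Submodule.subset_span ?_)
  exact Finset.mem_coe.mpr (Finset.mem_image_of_mem e hw)

/-- Automorphisms over the center preserve degrees. -/
theorem IsGradedDivisionRing.mem_of_ringEquiv [Module.Finite (Subring.center D) D]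
    (hD : IsGradedDivisionRing 𝒜) (hΓ : TorsionFree Γ) {L : Subring D}
    (hL : Subring.center D ≤ L) (σ : L ≃+* L)
    (hσ : ∀ y : L, (y : D) ∈ Subring.center D → σ y = y) {γ : Γ} (c : L) (hc : (c : D) ∈ 𝒜 γ) :
    (σ c : D) ∈ 𝒜 γ := by
  have := hD.isDomain hΓ
  by_cases hc0 : (c : D) = 0
  · have : c = 0 := Subtype.ext hc0
    rw [this, map_zero]
    exact zero_mem _
  obtain ⟨z, hz, hcz, hzc⟩ := hD.exists_inv hc hc0
  have hzL : z ∈ L := mem_of_mul_eq_one hL c.2 hcz hzc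
  have hunit : (σ c : D) * (σ ⟨z, hzL⟩ : D) = 1 := by
    have h1 : c * ⟨z, hzL⟩ = 1 := Subtype.ext hcz
    have h2 := congrArg (fun y => ((σ y : L) : D)) h1
    simpa using h2
  obtain ⟨δ, hδ⟩ := hD.isHomogeneousElem_of_mul_eq_one hΓ hunit
  obtain ⟨n, g, hg, hgd, h⟩ := exists_homogeneous_monic 𝒜 hc
  by_contra hne
  have hγδ : γ - δ ≠ 0 := fun h0 => hne (sub_eq_zero.mp h0 ▸ hδ)
  have h1 : ∑ i ∈ Finset.range n, (⟨g i, hL (hg i)⟩ : L) * c ^ i + c ^ n = 0 := by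
    apply Subtype.ext
    push_cast
    exact h
  have h2 := congrArg (fun y => ((σ y : L) : D)) h1
  simp only [map_add, map_sum, map_mul, map_pow, map_zero] at h2
  push_cast at h2
  have h3 := congrArg (GradedRing.proj 𝒜 (n • δ)) h2
  rw [map_add, map_zero, map_sum, proj_of_mem 𝒜 (SetLike.pow_mem_graded n hδ),
    Finset.sum_eq_zero, zero_add] at h3
  · exact left_ne_zero_of_mul_eq_one hunit (eq_zero_of_pow_eq_zero h3)
  · intro i hi
    have hin := Finset.mem_range.mp hi
    rw [hσ ⟨g i, hL (hg i)⟩ (hg i)]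
    have hmem := SetLike.mul_mem_graded (hgd i hin.le) (SetLike.pow_mem_graded i hδ)
    refine proj_of_mem_ne 𝒜 hmem fun heq => hγδ (hΓ _ (n - i) (by omega) ?_)
    obtain ⟨k, rfl⟩ := Nat.exists_eq_add_of_le hin.le
    rw [Nat.add_sub_cancel_left, smul_sub]
    rw [add_smul, add_smul, add_sub_cancel_left, add_comm (i • δ)] at heq
    exact sub_eq_zero.mpr (add_right_cancel heq)

end Finiteness

section MaximalSubfields

open Polynomial

theorem exists_intertwiner_of_isUnit {A : Type*} [Ring A] [Nontrivial A]
    (h : ∀ a : A, IsUnit a ∨ a = 0) [Module.Finite (Subring.center A) A] (φ : A ≃+* A)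
    (hφ : ∀ z ∈ Subring.center A, φ z = z) : ∃ y : A, y ≠ 0 ∧ ∀ c, c * y = y * φ c := by
  let : DivisionRing A := DivisionRing.ofIsUnitOrEqZero h
  exact exists_intertwiner φ hφ

variable {Γ : Type*} [AddCommGroup Γ] [DecidableEq Γ] {D : Type*} [Ring D]
  {𝒜 : Γ → AddSubgroup D} [GradedRing 𝒜]

theorem conj_mem_grade0 {γ : Γ} {p q x : D} (hp : p ∈ 𝒜 γ) (hq : q ∈ 𝒜 (-γ))
    (hx : x ∈ grade0 𝒜) : p * x * q ∈ grade0 𝒜 := by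
  have hx' : x ∈ 𝒜 0 := hx
  have h := SetLike.mul_mem_graded (SetLike.mul_mem_graded hp hx') hq
  rw [add_zero, add_neg_cancel] at h
  exact h

/-- A homogeneous element commuting with the center of `D₀` is, up to a factor in `D₀`, in the
centralizer of `D₀`. -/
theorem IsGradedDivisionRing.exists_eq_mul [Module.Finite (Subring.center D) D]
    (hD : IsGradedDivisionRing 𝒜) {γ : Γ} {p : D} (hp : p ∈ 𝒜 γ) (hp0 : p ≠ 0)
    (hpz : ∀ z ∈ grade0 𝒜, (∀ x ∈ grade0 𝒜, x * z = z * x) → z * p = p * z) :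
    ∃ a ∈ grade0 𝒜, ∃ c ∈ 𝒜 γ, (∀ x ∈ grade0 𝒜, x * c = c * x) ∧ p = a * c := by
  obtain ⟨q, hq, hpq, hqp⟩ := hD.exists_inv hp hp0
  have hq' : p ∈ 𝒜 (- -γ) := by rwa [neg_neg]
  let φ : grade0 𝒜 ≃+* grade0 𝒜 :=
    { toFun := fun x => ⟨p * x * q, conj_mem_grade0 hp hq x.2⟩
      invFun := fun x => ⟨q * x * p, conj_mem_grade0 hq hq' x.2⟩
      left_inv := fun x => Subtype.ext (by
        change q * (p * x * q) * p = x
        simp only [mul_assoc, hqp, mul_one]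
        rw [← mul_assoc, hqp, one_mul])
      right_inv := fun x => Subtype.ext (by
        change p * (q * x * p) * q = x
        simp only [mul_assoc, hpq, mul_one]
        rw [← mul_assoc, hpq, one_mul])
      map_mul' := fun x y => Subtype.ext (by
        change p * (x * y) * q = p * x * q * (p * y * q)
        simp only [mul_assoc]
        rw [← mul_assoc q p, hqp, one_mul])
      map_add' := fun x y => Subtype.ext (by
        change p * (x + y) * q = p * x * q + p * y * q
        rw [mul_add, add_mul]) }
  have : Nontrivial (grade0 𝒜) := ⟨0, 1, fun h => hD.1 (congrArg Subtype.val h)⟩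
  have := hD.finite_grade0
  obtain ⟨y, hy0, hy⟩ := exists_intertwiner_of_isUnit (A := grade0 𝒜) (fun a => by
      by_cases ha : a = 0
      · exact Or.inr ha
      · obtain ⟨b, hb, hab, hba⟩ := hD.exists_inv (x := (a : D)) a.2
          fun h => ha (Subtype.ext h)
        rw [neg_zero] at hb
        exact Or.inl ⟨⟨a, ⟨b, hb⟩, Subtype.ext hab, Subtype.ext hba⟩, rfl⟩) φ (fun z hz => by
      apply Subtype.ext
      change p * z * q = z
      rw [← hpz z z.2 fun x hx =>
        congrArg Subtype.val (Subring.mem_center_iff.mp hz ⟨x, hx⟩), mul_assoc, hpq, mul_one])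
  obtain ⟨a, ha, hya, hay⟩ := hD.exists_inv (x := (y : D)) y.2 fun h => hy0 (Subtype.ext h)
  rw [neg_zero] at ha
  refine ⟨a, ha, y * p, ?_, fun x hx => ?_, ?_⟩
  · have := SetLike.mul_mem_graded (show (y : D) ∈ 𝒜 0 from y.2) hp
    rwa [zero_add] at this
  · have h := congrArg (fun t : grade0 𝒜 => (t : D) * p) (hy ⟨x, hx⟩)
    change x * y * p = y * (p * x * q) * p at h
    rw [← mul_assoc, h]
    simp only [mul_assoc, hqp, mul_one]
  · rw [← mul_assoc, hay, one_mul]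

theorem closure_commute {S : Set D} (hS : ∀ x ∈ S, ∀ y ∈ S, x * y = y * x) :
    ∀ x ∈ Subring.closure S, ∀ y ∈ Subring.closure S, x * y = y * x := by
  intro x hx y hy
  have h1 : Subring.closure S ≤ Subring.centralizer S := by
    rw [Subring.closure_le]
    intro s hs
    rw [SetLike.mem_coe, Subring.mem_centralizer_iff]
    exact fun g hg => hS g hg s hs
  have h2 : Subring.closure S ≤ Subring.centralizer (Subring.closure S : Set D) := by
    rw [Subring.closure_le]
    intro s hs
    rw [SetLike.mem_coe, Subring.mem_centralizer_iff]
    exact fun g hg => (Subring.mem_centralizer_iff.mp (h1 hg) s hs).symm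
  exact Subring.mem_centralizer_iff.mp (h2 hy) x hx

theorem commute_closure {S : Set D} {x : D} (h : ∀ s ∈ S, s * x = x * s) :
    ∀ s ∈ Subring.closure S, s * x = x * s := by
  intro s hs
  have h1 : Subring.closure S ≤ Subring.centralizer {x} := by
    rw [Subring.closure_le]
    intro s hs
    rw [SetLike.mem_coe, Subring.mem_centralizer_iff]
    rintro _ rfl
    exact (h s hs).symm
  exact (Subring.mem_centralizer_iff.mp (h1 hs) x rfl).symm

variable (𝒜) in
theorem isGradedDivSubring_of_center_le [Module.Finite (Subring.center D) D]
    (hD : IsGradedDivisionRing 𝒜) {E : Subring D} (hE : Subring.center D ≤ E)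
    (hgr : IsGradedSubring 𝒜 E) : IsGradedDivSubring 𝒜 E := by
  refine ⟨hgr, fun γ x hx hxγ hx0 => ?_⟩
  obtain ⟨y, -, hxy, hyx⟩ := hD.exists_inv hxγ hx0
  exact ⟨y, mem_of_mul_eq_one hE hx hxy hyx, hxy, hyx⟩

theorem isGradedSubring_union {E : Subring D} {X : Set D} (hE : IsGradedSubring 𝒜 E)
    (hX : ∀ x ∈ X, SetLike.IsHomogeneousElem 𝒜 x) :
    IsGradedSubring 𝒜 (Subring.closure (E ∪ X)) := by
  refine isGradedSubring_closure 𝒜 ?_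
  rintro s (hs | hs) γ
  · exact Subring.subset_closure (Or.inl (hE s hs γ))
  · obtain ⟨δ, hδ⟩ := hX s hs
    by_cases h : δ = γ
    · subst h
      rw [proj_of_mem 𝒜 hδ]
      exact Subring.subset_closure (Or.inr hs)
    · rw [proj_of_mem_ne 𝒜 hδ h]
      exact zero_mem _

theorem isGradedSubring_center : IsGradedSubring 𝒜 (Subring.center D) :=
  fun _ hx γ => proj_mem_center 𝒜 hx γ

section

variable [Module.Finite (Subring.center D) D] (hD : IsGradedDivisionRing 𝒜)

include hD

theorem IsMaxGradedSubfieldOf.mem_of_commute {M : Subring D} (hM : IsMaxGradedSubfieldOf 𝒜 ⊤ M)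
    {γ : Γ} {x : D} (hx : x ∈ 𝒜 γ) (hc : ∀ m ∈ M, m * x = x * m) : x ∈ M := by
  let E := Subring.closure ((Subring.closure (M ∪ Subring.center D) : Subring D) ∪ {x} : Set D)
  have hME : M ≤ E := fun m hm =>
    Subring.subset_closure (Or.inl (Subring.subset_closure (Or.inl hm)))
  have hFE : Subring.center D ≤ E := fun m hm =>
    Subring.subset_closure (Or.inl (Subring.subset_closure (Or.inr hm)))
  have hgr : IsGradedSubring 𝒜 E := by
    refine isGradedSubring_union (isGradedSubring_closure 𝒜 ?_) ?_
    · rintro s (hs | hs) γ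
      · exact Subring.subset_closure (Or.inl (hM.1.1.1 s hs γ))
      · exact Subring.subset_closure (Or.inr (proj_mem_center 𝒜 hs γ))
    · rintro _ rfl
      exact ⟨γ, hx⟩
  have hx1 : ∀ s ∈ Subring.closure (M ∪ Subring.center D : Set D), s * x = x * s := by
    refine commute_closure ?_
    rintro s (hs | hs)
    · exact hc s hs
    · exact (Subring.mem_center_iff.mp hs x).symm
  have hcomm : ∀ y ∈ E, ∀ z ∈ E, y * z = z * y := by
    refine closure_commute ?_
    rintro y (hy | hy) z (hz | hz)
    · refine closure_commute ?_ y hy z hz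
      rintro y (hy | hy) z (hz | hz)
      · exact hM.1.2 y hy z hz
      · exact Subring.mem_center_iff.mp hz y
      · exact (Subring.mem_center_iff.mp hy z).symm
      · exact Subring.mem_center_iff.mp hz y
    · rw [Set.mem_singleton_iff.mp hz]
      exact hx1 y hy
    · rw [Set.mem_singleton_iff.mp hy]
      exact (hx1 z hz).symm
    · rw [Set.mem_singleton_iff.mp hy, Set.mem_singleton_iff.mp hz]
  rw [← hM.2.2 E ⟨isGradedDivSubring_of_center_le 𝒜 hD hFE hgr, hcomm⟩ le_top hME]
  exact Subring.subset_closure (Or.inr rfl)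

theorem IsMaxGradedSubfieldOf.center_le {M : Subring D} (hM : IsMaxGradedSubfieldOf 𝒜 ⊤ M) :
    Subring.center D ≤ M := fun _ hx =>
  mem_of_forall_proj_mem 𝒜 fun γ => hM.mem_of_commute hD (proj_mem 𝒜 γ _) fun m _ =>
    Subring.mem_center_iff.mp (proj_mem_center 𝒜 hx γ) m

theorem isMaxGradedSubfieldOf_of_commute {M : Subring D} (hgr : IsGradedSubring 𝒜 M)
    (hcomm : ∀ x ∈ M, ∀ y ∈ M, x * y = y * x) (hF : Subring.center D ≤ M)
    (h : ∀ γ, ∀ x ∈ 𝒜 γ, (∀ m ∈ M, m * x = x * m) → x ∈ M) : IsMaxGradedSubfieldOf 𝒜 ⊤ M := by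
  refine ⟨⟨isGradedDivSubring_of_center_le 𝒜 hD hF hgr, hcomm⟩, le_top, fun T' hT' _ hle => ?_⟩
  refine le_antisymm (fun x hx => ?_) hle
  exact mem_of_forall_proj_mem 𝒜 fun γ => h γ _ (proj_mem 𝒜 γ x) fun m hm =>
    hT'.2 m (hle hm) _ (hT'.1.1 x hx γ)

theorem isSubfieldOf_grade0 {N : Subring D} (hN : N ≤ grade0 𝒜)
    (hcomm : ∀ x ∈ N, ∀ y ∈ N, x * y = y * x) (hF : Subring.center D ⊓ grade0 𝒜 ≤ N) :
    IsSubfieldOf (grade0 𝒜) N := by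
  refine ⟨hN, hcomm, fun x hx hx0 => ?_⟩
  obtain ⟨y, hy, hxy, hyx⟩ := hD.exists_inv (hN hx) hx0
  rw [neg_zero] at hy
  exact ⟨y, mem_of_mul_eq_one_grade0 𝒜 hF hx hy hxy hyx, hxy, hyx⟩

theorem IsMaxSubfieldOf.mem_of_commute {N : Subring D} (hN : IsMaxSubfieldOf (grade0 𝒜) N)
    {x : D} (hx : x ∈ grade0 𝒜) (hc : ∀ m ∈ N, m * x = x * m) : x ∈ N := by
  let E := Subring.closure ((N ∪ (Subring.center D ⊓ grade0 𝒜 : Subring D)) ∪ {x} : Set D)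
  have hNE : N ≤ E := fun m hm => Subring.subset_closure (Or.inl (Or.inl hm))
  have hFE : Subring.center D ⊓ grade0 𝒜 ≤ E := fun m hm =>
    Subring.subset_closure (Or.inl (Or.inr hm))
  have hE0 : E ≤ grade0 𝒜 := by
    rw [Subring.closure_le]
    rintro s ((hs | hs) | hs)
    · exact hN.1.1 hs
    · exact hs.2
    · rw [Set.mem_singleton_iff.mp hs]
      exact hx
  have hcomm : ∀ y ∈ E, ∀ z ∈ E, y * z = z * y := by
    refine closure_commute ?_
    rintro y ((hy | hy) | hy) z ((hz | hz) | hz)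
    · exact hN.1.2.1 y hy z hz
    · exact Subring.mem_center_iff.mp hz.1 y
    · rw [Set.mem_singleton_iff.mp hz]
      exact hc y hy
    · exact (Subring.mem_center_iff.mp hy.1 z).symm
    · exact Subring.mem_center_iff.mp hz.1 y
    · exact (Subring.mem_center_iff.mp hy.1 z).symm
    · rw [Set.mem_singleton_iff.mp hy]
      exact (hc z hz).symm
    · exact Subring.mem_center_iff.mp hz.1 y
    · rw [Set.mem_singleton_iff.mp hy, Set.mem_singleton_iff.mp hz]
  rw [← hN.2 E (isSubfieldOf_grade0 hD hE0 hcomm hFE) hNE]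
  exact Subring.subset_closure (Or.inr rfl)

theorem IsMaxSubfieldOf.center_le {N : Subring D} (hN : IsMaxSubfieldOf (grade0 𝒜) N) :
    Subring.center D ⊓ grade0 𝒜 ≤ N := fun _ hx =>
  hN.mem_of_commute hD hx.2 fun m _ => Subring.mem_center_iff.mp hx.1 m

theorem isMaxSubfieldOf_of_commute {N : Subring D} (hN : N ≤ grade0 𝒜)
    (hcomm : ∀ x ∈ N, ∀ y ∈ N, x * y = y * x)
    (h : ∀ x ∈ grade0 𝒜, (∀ m ∈ N, m * x = x * m) → x ∈ N) : IsMaxSubfieldOf (grade0 𝒜) N := by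
  refine ⟨isSubfieldOf_grade0 hD hN hcomm fun x hx => h x hx.2 fun m _ =>
    Subring.mem_center_iff.mp hx.1 m, fun K hK hle => ?_⟩
  exact le_antisymm (fun x hx => h x (hK.1 hx) fun m hm => hK.2.1 m (hle hm) x hx) hle

end

end MaximalSubfields

section CentralizerSubfield

open Polynomial

variable {Γ : Type*} [AddCommGroup Γ] [DecidableEq Γ] {D : Type*} [Ring D]
  (𝒜 : Γ → AddSubgroup D) [GradedRing 𝒜]

/-- `T` is maximal among the commutative graded subrings of the centralizer of `D₀`. -/
structure IsMaxCentralizing (T : Subring D) : Prop where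
  graded : IsGradedSubring 𝒜 T
  comm : ∀ x ∈ T, ∀ y ∈ T, x * y = y * x
  commute_grade0 : ∀ t ∈ T, ∀ x ∈ grade0 𝒜, x * t = t * x
  mem_of_commute : ∀ γ, ∀ c ∈ 𝒜 γ, (∀ x ∈ grade0 𝒜, x * c = c * x) →
    (∀ t ∈ T, t * c = c * t) → c ∈ T

theorem exists_isMaxCentralizing : ∃ T : Subring D, IsMaxCentralizing 𝒜 T := by
  let P : Set (Set D) := {X | (∀ x ∈ X, SetLike.IsHomogeneousElem 𝒜 x) ∧
    (∀ t ∈ X, ∀ x ∈ grade0 𝒜, x * t = t * x) ∧ ∀ x ∈ X, ∀ y ∈ X, x * y = y * x}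
  obtain ⟨X, hX, hmax⟩ : ∃ X, Maximal (· ∈ P) X := by
    refine zorn_subset P fun c hc hchain => ⟨⋃₀ c, ⟨?_, ?_, ?_⟩, fun s hs =>
      Set.subset_sUnion_of_mem hs⟩
    · rintro x ⟨X, hX, hx⟩
      exact (hc hX).1 x hx
    · rintro x ⟨X, hX, hx⟩
      exact (hc hX).2.1 x hx
    · rintro x ⟨X, hX, hx⟩ y ⟨Y, hY, hy⟩
      rcases hchain.total hX hY with h | h
      · exact (hc hY).2.2 x (h hx) y hy
      · exact (hc hX).2.2 x hx y (h hy)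
  refine ⟨Subring.closure X, ?_, closure_commute hX.2.2, ?_, ?_⟩
  · refine isGradedSubring_closure 𝒜 fun s hs γ => ?_
    obtain ⟨δ, hδ⟩ := hX.1 s hs
    by_cases h : δ = γ
    · subst h
      rw [proj_of_mem 𝒜 hδ]
      exact Subring.subset_closure hs
    · rw [proj_of_mem_ne 𝒜 hδ h]
      exact zero_mem _
  · intro t ht x hx
    exact (commute_closure (fun s hs => (hX.2.1 s hs x hx).symm) t ht).symm
  · intro γ c hc hc0 hcT
    have hcX : ∀ t ∈ X, t * c = c * t := fun t ht => hcT t (Subring.subset_closure ht)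
    have hP : insert c X ∈ P := by
      refine ⟨?_, ?_, ?_⟩
      · rintro x (rfl | hx)
        · exact ⟨γ, hc⟩
        · exact hX.1 x hx
      · rintro t (rfl | ht)
        · exact hc0
        · exact hX.2.1 t ht
      · rintro x (rfl | hx) y (rfl | hy)
        · rfl
        · exact (hcX y hy).symm
        · exact hcX x hx
        · exact hX.2.2 x hx y hy
    exact Subring.subset_closure (hmax hP (Set.subset_insert c X) (Set.mem_insert c X))

variable {𝒜} {T : Subring D} (hT : IsMaxCentralizing 𝒜 T)

include hT

theorem IsMaxCentralizing.center_le : Subring.center D ≤ T := fun _ hx =>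
  mem_of_forall_proj_mem 𝒜 fun γ => hT.mem_of_commute γ _ (proj_mem 𝒜 γ _)
    (fun m _ => Subring.mem_center_iff.mp (proj_mem_center 𝒜 hx γ) m)
    fun m _ => Subring.mem_center_iff.mp (proj_mem_center 𝒜 hx γ) m

theorem IsMaxCentralizing.mem_of_center_grade0 {z : D} (hz : z ∈ grade0 𝒜)
    (h : ∀ x ∈ grade0 𝒜, x * z = z * x) : z ∈ T :=
  hT.mem_of_commute 0 z hz h fun t ht => (hT.commute_grade0 t ht z hz).symm

theorem IsMaxCentralizing.conj_mem [Module.Finite (Subring.center D) D]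
    (hD : IsGradedDivisionRing 𝒜) {γ : Γ} {d e : D} (hd : d ∈ 𝒜 γ)
    (hde : d * e = 1) {c : D} (hc : c ∈ T) : d * c * e ∈ T := by
  have he : e ∈ 𝒜 (-γ) := hD.mem_neg_of_mul_eq_one hd hde
  have hd' : d ∈ 𝒜 (- -γ) := by rwa [neg_neg]
  have key : ∀ δ, ∀ c ∈ T, c ∈ 𝒜 δ → d * c * e ∈ T := by
    intro δ c hc hcδ
    by_cases hc0 : c = 0
    · rw [hc0, mul_zero, zero_mul]
      exact zero_mem _
    obtain ⟨b, hb, hcb, hbc⟩ := hD.exists_inv hcδ hc0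
    have hbT : b ∈ T := mem_of_mul_eq_one hT.center_le hc hcb hbc
    have h1 : ∀ x ∈ grade0 𝒜, x * (d * c * e) = d * c * e * x := by
      intro x hx
      have h2 := hT.commute_grade0 c hc _ (conj_mem_grade0 he hd' hx)
      calc x * (d * c * e) = d * (e * x * d * c) * e := by
            simp only [← mul_assoc, hde, one_mul]
        _ = d * c * e * x := by
            rw [h2]
            simp only [mul_assoc, hde, mul_one]
    have h2 : d * c * e * b ∈ T := by
      refine hT.mem_of_center_grade0 ?_ fun x hx => ?_
      · have h := SetLike.mul_mem_graded
          (SetLike.mul_mem_graded (SetLike.mul_mem_graded hd hcδ) he) hb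
        have h0 : γ + δ + -γ + -δ = 0 := by abel
        rwa [h0] at h
      · rw [← mul_assoc, h1 x hx, mul_assoc, hT.commute_grade0 b hbT x hx]
        simp only [mul_assoc]
    have h3 := mul_mem h2 hc
    rwa [mul_assoc, hbc, mul_one] at h3
  classical
  rw [← DirectSum.sum_support_decompose 𝒜 c, Finset.mul_sum, Finset.sum_mul]
  exact sum_mem fun δ _ => key δ _ (hT.graded c hc δ) (proj_mem 𝒜 δ c)

/-- Conjugation by a homogeneous unit, as an automorphism of `T`. -/
def IsMaxCentralizing.conj [Module.Finite (Subring.center D) D]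
    (hD : IsGradedDivisionRing 𝒜) {γ : Γ} {d e : D} (hd : d ∈ 𝒜 γ)
    (hde : d * e = 1) (hed : e * d = 1) : T ≃+* T :=
  have he : e ∈ 𝒜 (-γ) := hD.mem_neg_of_mul_eq_one hd hde
  { toFun := fun x => ⟨d * x * e, hT.conj_mem hD hd hde x.2⟩
    invFun := fun x => ⟨e * x * d, hT.conj_mem hD he hed x.2⟩
    left_inv := fun x => Subtype.ext (by
      change e * (d * x * e) * d = x
      simp only [mul_assoc, hed, mul_one]
      rw [← mul_assoc, hed, one_mul])
    right_inv := fun x => Subtype.ext (by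
      change d * (e * x * d) * e = x
      simp only [mul_assoc, hde, mul_one]
      rw [← mul_assoc, hde, one_mul])
    map_mul' := fun x y => Subtype.ext (by
      change d * (x * y) * e = d * x * e * (d * y * e)
      simp only [mul_assoc]
      rw [← mul_assoc e d, hed, one_mul])
    map_add' := fun x y => Subtype.ext (by
      change d * (x + y) * e = d * x * e + d * y * e
      rw [mul_add, add_mul]) }

theorem IsMaxCentralizing.isGaloisExt [Module.Finite (Subring.center D) D]
    (hD : IsGradedDivisionRing 𝒜) : IsGaloisExt (Subring.center D) T := by
  refine ⟨hT.center_le, fun x hx => ?_⟩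
  rw [Subring.mem_center_iff]
  refine commute_of_forall_homogeneous 𝒜 ?_
  rintro d ⟨γ, hd⟩
  by_cases hd0 : d = 0
  · rw [hd0, zero_mul, mul_zero]
  obtain ⟨e, he, hde, hed⟩ := hD.exists_inv hd hd0
  let σ := hT.conj hD hd hde hed
  have h1 : d * x * e = x := congrArg Subtype.val (hx σ fun y hy => Subtype.ext (by
    change d * y * e = y
    rw [Subring.mem_center_iff.mp hy d, mul_assoc, hde, mul_one]))
  conv_rhs => rw [← h1]
  rw [mul_assoc, hed, mul_one]

theorem IsMaxCentralizing.isSplitRoot [Module.Finite (Subring.center D) D] [IsDomain D]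
    (hD : IsGradedDivisionRing 𝒜) {t : D} (ht : t ∈ T) :
    IsSplitRoot True (Subring.center D) T t := by
  obtain ⟨l, h1, h2, h3, h4⟩ := exists_conjugates_list_of_isGaloisExt hT.center_le hT.comm
    (hT.isGaloisExt hD) ⟨t, ht⟩ (exists_monic_center t)
  refine ⟨l, h1, fun a ha => ?_, fun _ => h2, h4⟩
  obtain ⟨σ, -, rfl⟩ := h3 a ha
  exact (σ _).2

end CentralizerSubfield

section Lift

open Polynomial

variable {Γ : Type*} [AddCommGroup Γ] [DecidableEq Γ] {D : Type*} [Ring D]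
  {𝒜 : Γ → AddSubgroup D} [GradedRing 𝒜]

theorem mem_center_of_mul_mem [IsDomain D] {f x : D} (hf : f ∈ Subring.center D) (hf0 : f ≠ 0)
    (hfx : f * x ∈ Subring.center D) : x ∈ Subring.center D := by
  rw [Subring.mem_center_iff] at *
  intro g
  apply mul_left_cancel₀ hf0
  rw [← mul_assoc, ← hf g, mul_assoc, hfx g, mul_assoc]

theorem commute_of_commute_mul {x c e t : D} (hce : c * e = 1) (hx : t * x = x * t)
    (hc : t * c = c * t) (hec : e * c = 1) : ∀ a, x = a * c → t * a = a * t := by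
  intro a ha
  have h : a = x * e := by rw [ha, mul_assoc, hce, mul_one]
  have he : t * e = e * t := by
    calc t * e = e * c * t * e := by rw [hec, one_mul]
      _ = e * (c * t) * e := by rw [mul_assoc e]
      _ = e * t := by rw [← hc, mul_assoc, mul_assoc, hce, mul_one]
  rw [h, ← mul_assoc, hx, mul_assoc, he, mul_assoc]

variable [Module.Finite (Subring.center D) D] (hD : IsGradedDivisionRing 𝒜)

include hD

theorem exists_isMaxGradedSubfieldOf_of_isMaxSubfieldOf {sep : Prop}
    {N : Subring D} [IsDomain D] (hN : IsMaxSubfieldOf (grade0 𝒜) N)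
    (hsp : ∀ c ∈ N, IsSplitRoot sep (Subring.center D ⊓ grade0 𝒜) N c) :
    ∃ P : Subring D, IsMaxGradedSubfieldOf 𝒜 ⊤ P ∧ Subring.center D ≤ P ∧
      ∃ S : Set D, P = Subring.closure (Subring.center D ∪ S) ∧
        ∀ c ∈ S, IsSplitRoot sep (Subring.center D) P c := by
  obtain ⟨T, hT⟩ := exists_isMaxCentralizing 𝒜
  let P := Subring.closure (Subring.center D ∪ (N ∪ T : Set D))
  have hNP : N ≤ P := fun x hx => Subring.subset_closure (Or.inr (Or.inl hx))
  have hTP : T ≤ P := fun x hx => Subring.subset_closure (Or.inr (Or.inr hx))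
  have hFP : Subring.center D ≤ P := fun x hx => Subring.subset_closure (Or.inl hx)
  have hN0 : N ≤ grade0 𝒜 := hN.1.1
  have hgr : IsGradedSubring 𝒜 P := by
    refine isGradedSubring_closure 𝒜 ?_
    rintro s (hs | hs | hs) γ
    · exact hFP (isGradedSubring_center s hs γ)
    · by_cases h : 0 = γ
      · subst h
        rw [proj_of_mem 𝒜 (hN0 hs)]
        exact hNP hs
      · rw [proj_of_mem_ne 𝒜 (hN0 hs) h]
        exact zero_mem _
    · exact hTP (hT.graded s hs γ)
  have hcomm : ∀ x ∈ P, ∀ y ∈ P, x * y = y * x := by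
    refine closure_commute ?_
    rintro x (hx | hx | hx) y (hy | hy | hy)
    · exact Subring.mem_center_iff.mp hy x
    · exact (Subring.mem_center_iff.mp hx y).symm
    · exact (Subring.mem_center_iff.mp hx y).symm
    · exact Subring.mem_center_iff.mp hy x
    · exact hN.1.2.1 x hx y hy
    · exact hT.commute_grade0 y hy x (hN0 hx)
    · exact Subring.mem_center_iff.mp hy x
    · exact (hT.commute_grade0 x hx y (hN0 hy)).symm
    · exact hT.comm x hx y hy
  refine ⟨P, isMaxGradedSubfieldOf_of_commute hD hgr hcomm hFP ?_, hFP, N ∪ T, rfl, ?_⟩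
  · intro γ x hx hxP
    by_cases hx0 : x = 0
    · rw [hx0]
      exact zero_mem _
    obtain ⟨a, ha, c, hc, hc0, rfl⟩ := hD.exists_eq_mul hx hx0 fun z hz h =>
      hxP z (hTP (hT.mem_of_center_grade0 hz h))
    obtain ⟨e, he, hce, hec⟩ := hD.exists_inv hc (right_ne_zero_of_mul hx0)
    have ha0 : a ≠ 0 := left_ne_zero_of_mul hx0
    have hcT : c ∈ T := by
      refine hT.mem_of_commute γ c hc hc0 fun t ht => ?_
      apply mul_left_cancel₀ ha0
      rw [← mul_assoc, hT.commute_grade0 t ht a ha, mul_assoc, hxP t (hTP ht), mul_assoc]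
    have haN : a ∈ N := hN.mem_of_commute hD ha fun m hm =>
      commute_of_commute_mul hce (hxP m (hNP hm)) (hc0 m (hN0 hm)) hec a rfl
    exact mul_mem (hNP haN) (hTP hcT)
  · rintro c (hc | hc)
    · exact (hsp c hc).mono id inf_le_left hNP
    · exact (hT.isSplitRoot hD hc).mono (fun _ => trivial) le_rfl hTP

end Lift

section Descent

/-- Finitely many automorphisms of a commutative ring, each moving some element by a unit, can be
separated from the identity by a dual system. -/
theorem exists_dual_system {R : Type*} [Ring R] (hcomm : ∀ x y : R, x * y = y * x)
    (s : Finset (R ≃+* R)) (hs : ∀ g ∈ s, ∃ r v : R, v * (r - g r) = 1) :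
    ∃ (ι : Type) (_ : Fintype ι) (t r : ι → R), ∑ i, t i * r i = 1 ∧
      ∀ g ∈ s, ∑ i, t i * g (r i) = 0 := by
  classical
  have mul_mul (a b c d : R) : a * b * (c * d) = a * c * (b * d) := by
    rw [mul_assoc, ← mul_assoc b, hcomm b c, mul_assoc c, ← mul_assoc]
  induction s using Finset.induction_on with
  | empty => exact ⟨Unit, inferInstance, 1, 1, by simp, by simp⟩
  | insert g s _ ih =>
    obtain ⟨ι, _, t, r, h1, h0⟩ := ih fun g hg => hs g (Finset.mem_insert_of_mem hg)
    obtain ⟨q, v, hv⟩ := hs g (Finset.mem_insert_self g s)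
    refine ⟨ι × Bool, inferInstance, fun i => t i.1 * (bif i.2 then v else -(v * g q)),
      fun i => r i.1 * (bif i.2 then q else 1), ?_, fun f hf => ?_⟩
    · simp only [mul_mul, Fintype.sum_prod_type]
      rw [← Finset.sum_mul_sum, h1, Fintype.sum_bool]
      simp only [cond_true, cond_false, mul_one, one_mul]
      rw [← sub_eq_add_neg, ← mul_sub, hv]
    · simp only [map_mul, mul_mul, Fintype.sum_prod_type]
      rw [← Finset.sum_mul_sum]
      rcases Finset.mem_insert.mp hf with rfl | hf
      · rw [Fintype.sum_bool]
        simp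
      · rw [h0 f hf, zero_mul]

variable {Γ : Type*} [AddCommGroup Γ] [DecidableEq Γ] {D : Type*} [Ring D]
  {𝒜 : Γ → AddSubgroup D} [GradedRing 𝒜]

theorem commute_of_isGradedSubring {E : Subring D} (hE : IsGradedSubring 𝒜 E) {x : D}
    (h : ∀ γ, ∀ s ∈ E, s ∈ 𝒜 γ → s * x = x * s) : ∀ s ∈ E, s * x = x * s := by
  classical
  intro s hs
  rw [← DirectSum.sum_support_decompose 𝒜 s, Finset.mul_sum, Finset.sum_mul]
  exact Finset.sum_congr rfl fun γ _ => h γ _ (hE s hs γ) (proj_mem 𝒜 γ s)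

theorem IsGradedSubring.commute_proj {E : Subring D} (hE : IsGradedSubring 𝒜 E) {x : D}
    (h : ∀ s ∈ E, s * x = x * s) (γ : Γ) :
    ∀ s ∈ E, s * GradedRing.proj 𝒜 γ x = GradedRing.proj 𝒜 γ x * s :=
  commute_of_isGradedSubring hE fun δ s hs hsδ =>
    proj_mem_centralizer 𝒜 (S := {s | s ∈ E ∧ ∃ δ, s ∈ 𝒜 δ}) (fun _ h => h.2)
      (fun s hs => h s hs.1) γ s ⟨hs, δ, hsδ⟩

theorem commute_conj {a b m e t : D} (hme : m * e = 1)
    (h : (e * b) * t = t * (e * b)) (hba : b * a = 1) : m * t * e = b * t * a := by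
  have hb : b = m * (e * b) := by rw [← mul_assoc, hme, one_mul]
  calc m * t * e = m * t * e * (b * a) := by rw [hba, mul_one]
    _ = m * (t * (e * b)) * a := by simp only [mul_assoc]
    _ = m * (e * b) * t * a := by rw [← h]; simp only [mul_assoc]
    _ = b * t * a := by rw [← hb]

/-- The automorphism `σ` of `T` is conjugation by a homogeneous unit `m` of `M` with inverse
`e`. -/
structure IsConjBy (𝒜 : Γ → AddSubgroup D) (M T : Subring D) (σ : T ≃+* T) (m e : D) : Prop where
  mem : m ∈ M
  mem_inv : e ∈ M
  homogeneous : ∃ γ, m ∈ 𝒜 γ ∧ e ∈ 𝒜 (-γ)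
  mul_inv : m * e = 1
  inv_mul : e * m = 1
  apply : ∀ t : T, (σ t : D) = m * t * e

theorem IsConjBy.mul {M T : Subring D} {σ τ : T ≃+* T} {m e n f : D}
    (hσ : IsConjBy 𝒜 M T σ m e) (hτ : IsConjBy 𝒜 M T τ n f) :
    IsConjBy 𝒜 M T (τ.trans σ) (m * n) (f * e) := by
  obtain ⟨γ, hm, he⟩ := hσ.homogeneous
  obtain ⟨δ, hn, hf⟩ := hτ.homogeneous
  refine ⟨mul_mem hσ.mem hτ.mem, mul_mem hτ.mem_inv hσ.mem_inv,
    ⟨γ + δ, SetLike.mul_mem_graded hm hn, ?_⟩, ?_, ?_, fun t => ?_⟩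
  · rw [neg_add_rev]
    exact SetLike.mul_mem_graded hf he
  · rw [mul_assoc, ← mul_assoc n, hτ.mul_inv, one_mul, hσ.mul_inv]
  · rw [mul_assoc, ← mul_assoc e, hσ.inv_mul, one_mul, hτ.inv_mul]
  · rw [RingEquiv.trans_apply, hσ.apply, hτ.apply]
    simp only [mul_assoc]

variable [Module.Finite (Subring.center D) D] (hD : IsGradedDivisionRing 𝒜)

include hD

theorem finite_isConjBy {M T : Subring D} (hT : IsMaxCentralizing 𝒜 T) :
    {σ : T ≃+* T | ∃ m e, IsConjBy 𝒜 M T σ m e}.Finite := by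
  obtain ⟨W, hW⟩ := exists_finite_degrees 𝒜
  have key : ∀ σ : T ≃+* T, (∃ m e, IsConjBy 𝒜 M T σ m e) →
      ∃ δ ∈ W, ∃ n f, n ∈ 𝒜 δ ∧ f ∈ 𝒜 (-δ) ∧ n * f = 1 ∧ f * n = 1 ∧
        ∀ t : T, (σ t : D) = n * t * f := by
    rintro σ ⟨m, e, h⟩
    obtain ⟨γ, hm, he⟩ := h.homogeneous
    have hm0 : m ≠ 0 := by
      rintro rfl
      exact hD.1 (by rw [← h.mul_inv, zero_mul])
    obtain ⟨δ, hδ, φ, hφ, hφγ, hφ0⟩ := hW γ m hm hm0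
    obtain ⟨ψ, hψ, hφψ, hψφ⟩ := hD.exists_inv hφγ hφ0
    have hψF : ψ ∈ Subring.center D := mem_of_mul_eq_one le_rfl hφ hφψ hψφ
    have h1 := Subring.mem_center_iff.mp hφ
    have h2 := Subring.mem_center_iff.mp hψF
    refine ⟨δ, hδ, m * ψ, φ * e, ?_, ?_, ?_, ?_, fun t => ?_⟩
    · have h := SetLike.mul_mem_graded hm hψ
      rwa [show γ + -(γ - δ) = δ by abel] at h
    · have h := SetLike.mul_mem_graded hφγ he
      rwa [show γ - δ + -γ = -δ by abel] at h
    · rw [mul_assoc, ← mul_assoc ψ, hψφ, one_mul, h.mul_inv]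
    · rw [mul_assoc, ← mul_assoc e, h.inv_mul, one_mul, hφψ]
    · rw [h.apply, mul_assoc m ψ, ← h2 t]
      simp only [mul_assoc]
      rw [← mul_assoc ψ, hψφ, one_mul]
  choose! f hfW hf using key
  refine Set.Finite.of_injOn (f := f) (t := W) (fun σ hσ => hfW σ hσ) ?_ W.finite_toSet
  intro σ hσ τ hτ hst
  obtain ⟨n, p, hn, hp, hnp, hpn, h1⟩ := hf σ hσ
  obtain ⟨n', p', hn', hp', hnp', hpn', h2⟩ := hf τ hτ
  rw [← hst] at hn'
  ext t
  rw [h1, h2]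
  refine commute_conj hnp ?_ hnp'
  refine hT.commute_grade0 t t.2 _ ?_
  have h := SetLike.mul_mem_graded hp hn'
  rwa [neg_add_cancel] at h

theorem IsMaxCentralizing.exists_sub_isUnit [IsDomain D] {M T : Subring D}
    (hT : IsMaxCentralizing 𝒜 T) {σ : T ≃+* T} {m e : D} (hσ : IsConjBy 𝒜 M T σ m e)
    (hne : σ ≠ RingEquiv.refl T) : ∃ r v : T, v * (r - σ r) = 1 := by
  obtain ⟨γ, hm, he⟩ := hσ.homogeneous
  by_contra! hcon
  refine hne (RingEquiv.ext fun t => Subtype.ext ?_)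
  rw [hσ.apply, RingEquiv.refl_apply]
  have key : ∀ s ∈ T, s * m = m * s := by
    refine commute_of_isGradedSubring hT.graded fun δ s hs hsδ => ?_
    have hσs : (σ ⟨s, hs⟩ : D) ∈ 𝒜 δ := by
      rw [hσ.apply]
      have h := SetLike.mul_mem_graded (SetLike.mul_mem_graded hm hsδ) he
      rwa [show γ + δ + -γ = δ by abel] at h
    by_cases h0 : s - σ ⟨s, hs⟩ = 0
    · rw [sub_eq_zero, hσ.apply] at h0
      conv_lhs => rw [h0]
      rw [mul_assoc, hσ.inv_mul, mul_one]
    · obtain ⟨v, -, h1, h2⟩ := hD.exists_inv (sub_mem hsδ hσs) h0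
      have hvT : v ∈ T := mem_of_mul_eq_one hT.center_le (sub_mem hs (σ ⟨s, hs⟩).2) h1 h2
      exact absurd (Subtype.ext h2) (hcon ⟨s, hs⟩ ⟨v, hvT⟩)
  rw [← key t t.2, mul_assoc, hσ.mul_inv, mul_one]

/-- An element commuting with `T` and with the homogeneous elements of `M` which commute with `T`
is a `T`-linear combination of such elements of `M`. -/
theorem IsMaxCentralizing.mem_of_commute_centralizer [IsDomain D] {M T P : Subring D}
    (hT : IsMaxCentralizing 𝒜 T) (hM : IsMaxGradedSubfieldOf 𝒜 ⊤ M) (hTP : T ≤ P)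
    (hKP : ∀ γ, ∀ k ∈ M, k ∈ 𝒜 γ → (∀ t ∈ T, t * k = k * t) → k ∈ P) {x : D}
    (hxT : ∀ t ∈ T, t * x = x * t)
    (hxK : ∀ γ, ∀ k ∈ M, k ∈ 𝒜 γ → (∀ t ∈ T, t * k = k * t) → k * x = x * k) : x ∈ P := by
  classical
  let S := (finite_isConjBy (M := M) hD hT).toFinset
  have hS : ∀ σ, σ ∈ S ↔ ∃ m e, IsConjBy 𝒜 M T σ m e := fun σ => Set.Finite.mem_toFinset _
  obtain ⟨ι, _, t, r, h1, h0⟩ := exists_dual_system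
    (fun x y : T => Subtype.ext (hT.comm x x.2 y y.2)) (S.erase (RingEquiv.refl T))
    fun σ hσ => by
      obtain ⟨hne, hσ⟩ := Finset.mem_erase.mp hσ
      obtain ⟨m, e, h⟩ := (hS σ).mp hσ
      exact hT.exists_sub_isUnit hD h hne
  have hconj : ∀ σ m e n f, IsConjBy 𝒜 M T σ m e → IsConjBy 𝒜 M T σ n f →
      m * x * e = n * x * f := by
    intro σ m e n f hm hn
    refine commute_conj hm.mul_inv ?_ hn.mul_inv
    obtain ⟨γ, hmγ, heγ⟩ := hm.homogeneous
    obtain ⟨δ, hnδ, hfδ⟩ := hn.homogeneous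
    refine hxK (-γ + δ) _ (mul_mem hm.mem_inv hn.mem) (SetLike.mul_mem_graded heγ hnδ) ?_
    intro t ht
    have h := (hm.apply ⟨t, ht⟩).symm.trans (hn.apply ⟨t, ht⟩)
    change m * t * e = n * t * f at h
    calc t * (e * n) = e * m * t * (e * n) := by rw [hm.inv_mul, one_mul]
      _ = e * (m * t * e) * n := by simp only [mul_assoc]
      _ = e * n * t := by rw [h]; simp only [mul_assoc, hn.inv_mul, mul_one]
  have hX : ∀ σ : T ≃+* T, ∃ X : D, ∀ m e, IsConjBy 𝒜 M T σ m e → X = m * x * e := by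
    intro σ
    by_cases h : ∃ m e, IsConjBy 𝒜 M T σ m e
    · obtain ⟨m, e, h⟩ := h
      exact ⟨m * x * e, fun n f hn => hconj σ m e n f h hn⟩
    · exact ⟨0, fun m e hm => absurd ⟨m, e, hm⟩ h⟩
  choose X hX using hX
  let tr : T → D := fun s => ∑ σ ∈ S, (σ s : D) * X σ
  have hrefl : IsConjBy 𝒜 M T (RingEquiv.refl T) 1 1 := by
    refine ⟨one_mem _, one_mem _, ⟨0, SetLike.one_mem_graded 𝒜, ?_⟩, mul_one 1, mul_one 1,
      fun t => ?_⟩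
    · rw [neg_zero]
      exact SetLike.one_mem_graded 𝒜
    · rw [one_mul, mul_one]
      rfl
  have hxsum : x = ∑ i, (t i : D) * tr (r i) := by
    have h2 : ∑ i, (t i : D) * tr (r i) = ∑ σ ∈ S, ((∑ i, t i * σ (r i) : T) : D) * X σ := by
      simp only [tr, Finset.mul_sum]
      rw [Finset.sum_comm]
      refine Finset.sum_congr rfl fun σ _ => ?_
      rw [AddSubmonoidClass.coe_finsetSum, Finset.sum_mul]
      refine Finset.sum_congr rfl fun i _ => ?_
      rw [Subring.coe_mul, mul_assoc]
    rw [h2, Finset.sum_eq_single (RingEquiv.refl T)]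
    · simp only [RingEquiv.refl_apply]
      rw [h1, hX _ 1 1 hrefl, Subring.coe_one]
      simp only [one_mul, mul_one]
    · intro σ hσ hne
      rw [h0 σ (Finset.mem_erase.mpr ⟨hne, hσ⟩), Subring.coe_zero, zero_mul]
    · exact fun h => absurd ((hS _).mpr ⟨1, 1, hrefl⟩) h
  have htrT : ∀ s, ∀ u ∈ T, u * tr s = tr s * u := by
    intro s u hu
    simp only [tr, Finset.mul_sum, Finset.sum_mul]
    refine Finset.sum_congr rfl fun σ hσ => ?_
    obtain ⟨m, e, h⟩ := (hS σ).mp hσ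
    obtain ⟨v, hv⟩ := σ.surjective ⟨u, hu⟩
    have hu' : u = m * v * e := by rw [← h.apply, hv]
    rw [hX σ m e h, h.apply, hu']
    have h3 : (v : D) * (s * x) = s * x * v := by
      rw [← mul_assoc, hT.comm v v.2 s s.2, mul_assoc, hxT v v.2, mul_assoc]
    have h4 : ∀ y : D, e * (m * y) = y := fun y => by rw [← mul_assoc, h.inv_mul, one_mul]
    have h5 : (v : D) * (s * (x * e)) = s * (x * (v * e)) := by
      rw [← mul_assoc (s : D), ← mul_assoc (v : D), h3]
      simp only [mul_assoc]
    simp only [mul_assoc, h4, h5]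
  have htrM : ∀ s, ∀ n ∈ M, n * tr s = tr s * n := by
    intro s
    refine commute_of_isGradedSubring hM.1.1.1 fun δ n hn hnδ => ?_
    by_cases hn0 : n = 0
    · rw [hn0, zero_mul, mul_zero]
    obtain ⟨f, hf, hnf, hfn⟩ := hD.exists_inv hnδ hn0
    have hfM : f ∈ M := mem_of_mul_eq_one (hM.center_le hD) hn hnf hfn
    let ν := hT.conj hD hnδ hnf hfn
    have hν : IsConjBy 𝒜 M T ν n f := ⟨hn, hfM, ⟨δ, hnδ, hf⟩, hnf, hfn, fun t => rfl⟩
    have hν' : IsConjBy 𝒜 M T ν.symm f n :=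
      ⟨hfM, hn, ⟨-δ, hf, by rwa [neg_neg]⟩, hfn, hnf, fun t => rfl⟩
    have h2 : n * tr s * f = tr s := by
      simp only [tr, Finset.mul_sum, Finset.sum_mul]
      refine Finset.sum_nbij' (fun σ => σ.trans ν) (fun σ => σ.trans ν.symm) ?_ ?_ ?_ ?_ ?_
      · intro σ hσ
        obtain ⟨m, e, h⟩ := (hS σ).mp hσ
        exact (hS _).mpr ⟨_, _, hν.mul h⟩
      · intro σ hσ
        obtain ⟨m, e, h⟩ := (hS σ).mp hσ
        exact (hS _).mpr ⟨_, _, hν'.mul h⟩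
      · intro σ _
        ext t
        simp
      · intro σ _
        ext t
        simp
      · intro σ hσ
        obtain ⟨m, e, h⟩ := (hS σ).mp hσ
        rw [hX σ m e h, hX _ _ _ (hν.mul h), RingEquiv.trans_apply, hν.apply]
        simp only [mul_assoc]
        rw [← mul_assoc f, hfn, one_mul]
    conv_rhs => rw [← h2]
    rw [mul_assoc, hfn, mul_one]
  rw [hxsum]
  refine sum_mem fun i _ => mul_mem (hTP (t i).2) ?_
  refine mem_of_forall_proj_mem 𝒜 fun γ => ?_
  refine hKP γ _ ?_ (proj_mem 𝒜 γ _) (hT.graded.commute_proj (htrT (r i)) γ)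
  exact hM.mem_of_commute hD (proj_mem 𝒜 γ _) (hM.1.1.1.commute_proj (htrM (r i)) γ)

end Descent

section Restrict

open Polynomial

variable {Γ : Type*} [AddCommGroup Γ] [DecidableEq Γ] {D : Type*} [Ring D]
  {𝒜 : Γ → AddSubgroup D} [GradedRing 𝒜]

theorem coeff_prod_X_sub_C_mem {L : Subring D} {l : List D} (h : ∀ a ∈ l, a ∈ L) (i : ℕ) :
    ((l.map fun a => X - C a).prod).coeff i ∈ L := by
  obtain ⟨l', rfl⟩ := exists_list_of_forall_mem h
  rw [← map_subtype_prod_X_sub_C, coeff_map]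
  exact (((l'.map fun a => X - C a).prod).coeff i).2

variable [Module.Finite (Subring.center D) D] (hD : IsGradedDivisionRing 𝒜)

include hD

theorem exists_isMaxSubfieldOf_of_isMaxGradedSubfieldOf {sep : Prop} (hΓ : TorsionFree Γ)
    {M : Subring D} (hM : IsMaxGradedSubfieldOf 𝒜 ⊤ M)
    (hsp : ∀ γ, ∀ c : M, (c : D) ∈ 𝒜 γ → ∃ l : List D, (c : D) ∈ l ∧ (sep → l.Nodup) ∧
      AreConjugates (Subring.center D) M c l ∧
      ∀ i, ((l.map fun a => X - C a).prod).coeff i ∈ Subring.center D) :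
    ∃ N : Subring D, IsMaxSubfieldOf (grade0 𝒜) N ∧ Subring.center D ⊓ grade0 𝒜 ≤ N ∧
      ∀ c ∈ N, IsSplitRoot sep (Subring.center D ⊓ grade0 𝒜) N c := by
  have := hD.isDomain hΓ
  have hFM := hM.center_le hD
  obtain ⟨T, hT⟩ := exists_isMaxCentralizing 𝒜
  let K : Set D := {k | k ∈ M ∧ (∃ γ, k ∈ 𝒜 γ) ∧ ∀ t ∈ T, t * k = k * t}
  let P := Subring.closure (Subring.center D ∪ (K ∪ T : Set D))
  have hKP : ∀ k ∈ K, k ∈ P := fun x hx => Subring.subset_closure (Or.inr (Or.inl hx))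
  have hTP : T ≤ P := fun x hx => Subring.subset_closure (Or.inr (Or.inr hx))
  have hFP : Subring.center D ≤ P := fun x hx => Subring.subset_closure (Or.inl hx)
  have hcomm : ∀ x ∈ P, ∀ y ∈ P, x * y = y * x := by
    refine closure_commute ?_
    rintro x (hx | hx | hx) y (hy | hy | hy)
    · exact Subring.mem_center_iff.mp hy x
    · exact (Subring.mem_center_iff.mp hx y).symm
    · exact (Subring.mem_center_iff.mp hx y).symm
    · exact Subring.mem_center_iff.mp hy x
    · exact hM.1.2 x hx.1 y hy.1
    · exact (hx.2.2 y hy).symm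
    · exact Subring.mem_center_iff.mp hy x
    · exact hy.2.2 x hx
    · exact hT.comm x hx y hy
  have hsplit : ∀ c ∈ (K ∪ T : Set D), IsSplitRoot sep (Subring.center D) P c := by
    rintro c (⟨hcM, ⟨γ, hc⟩, hcT⟩ | hc)
    · obtain ⟨l, h1, h2, h3, h4⟩ := hsp γ ⟨c, hcM⟩ hc
      refine ⟨l, h1, fun a ha => hKP a ?_, h2, h4⟩
      obtain ⟨σ, hσ, rfl⟩ := h3 a ha
      have hσc := hD.mem_of_ringEquiv hΓ hFM σ hσ ⟨c, hcM⟩ hc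
      refine ⟨(σ _).2, ⟨γ, hσc⟩, fun t ht => ?_⟩
      by_cases hc0 : c = 0
      · have h0 : (⟨c, hcM⟩ : M) = 0 := Subtype.ext hc0
        rw [h0, map_zero, Subring.coe_zero, mul_zero, zero_mul]
      obtain ⟨b, hb, hcb, hbc⟩ := hD.exists_inv hc hc0
      have h5 : (σ ⟨c, hcM⟩ : D) * b ∈ grade0 𝒜 := by
        have h := SetLike.mul_mem_graded hσc hb
        rwa [add_neg_cancel] at h
      have h6 : (σ ⟨c, hcM⟩ : D) = σ ⟨c, hcM⟩ * b * c := by rw [mul_assoc, hbc, mul_one]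
      rw [h6, ← mul_assoc, ← hT.commute_grade0 t ht _ h5, mul_assoc, hcT t ht]
      simp only [mul_assoc]
    · exact (hT.isSplitRoot hD hc).mono (fun _ => trivial) le_rfl hTP
  have hPmem : ∀ x ∈ grade0 𝒜, (∀ m ∈ P ⊓ grade0 𝒜, m * x = x * m) → x ∈ P := by
    intro x hx hxN
    refine hT.mem_of_commute_centralizer hD hM hTP
      (fun γ k hk hkγ hkT => hKP k ⟨hk, ⟨γ, hkγ⟩, hkT⟩)
      (fun t ht => (hT.commute_grade0 t ht x hx).symm) fun γ k hk hkγ hkT => ?_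
    by_cases hk0 : k = 0
    · rw [hk0, mul_zero, zero_mul]
    have hkP := hKP k ⟨hk, ⟨γ, hkγ⟩, hkT⟩
    obtain ⟨a, ha, c, hc, hc0, rfl⟩ := hD.exists_eq_mul hkγ hk0 fun z hz h =>
      hkT z (hT.mem_of_center_grade0 hz h)
    have ha0 : a ≠ 0 := left_ne_zero_of_mul hk0
    have hcT : c ∈ T := by
      refine hT.mem_of_commute γ c hc hc0 fun t ht => ?_
      apply mul_left_cancel₀ ha0
      rw [← mul_assoc, hT.commute_grade0 t ht a ha, mul_assoc, hkT t ht, mul_assoc]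
    obtain ⟨e, -, hce, hec⟩ := hD.exists_inv hc (right_ne_zero_of_mul hk0)
    have haP : a ∈ P := by
      have h := mul_mem hkP (hTP (mem_of_mul_eq_one hT.center_le hcT hce hec))
      rwa [mul_assoc, hce, mul_one] at h
    rw [mul_assoc, ← hc0 x hx, ← mul_assoc, hxN a ⟨haP, ha⟩, mul_assoc]
  have hNcomm : ∀ x ∈ P ⊓ grade0 𝒜, ∀ y ∈ P ⊓ grade0 𝒜, x * y = y * x :=
    fun x hx y hy => hcomm x hx.1 y hy.1
  refine ⟨P ⊓ grade0 𝒜, isMaxSubfieldOf_of_commute hD inf_le_right hNcomm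
    fun x hx h => ⟨hPmem x hx h, hx⟩, inf_le_inf_right _ hFP, fun c hc => ?_⟩
  obtain ⟨l, h1, h2, h3, h4⟩ := exists_conjugates_list hFP hcomm
    (fun f hf hf0 x _ hfx => mem_center_of_mul_mem hf hf0 hfx) (K ∪ T) rfl hsplit ⟨c, hc.1⟩
  have hl : ∀ a ∈ l, a ∈ P ⊓ grade0 𝒜 := by
    intro a ha
    obtain ⟨σ, hσ, rfl⟩ := h3 a ha
    exact ⟨(σ _).2, hD.mem_of_ringEquiv hΓ hFP σ hσ ⟨c, hc.1⟩ hc.2⟩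
  exact ⟨l, h1, hl, h2, fun i => ⟨h4 i, coeff_prod_X_sub_C_mem (fun a ha => (hl a ha).2) i⟩⟩

end Restrict

section Main

variable {Γ : Type*} [AddCommGroup Γ] [DecidableEq Γ] {D : Type*} [Ring D]
  {𝒜 : Γ → AddSubgroup D} [GradedRing 𝒜]
  [Module.Finite (Subring.center D) D] (hD : IsGradedDivisionRing 𝒜) (hΓ : TorsionFree Γ)

include hD hΓ

theorem exists_isMaxGradedSubfieldOf_isGaloisExt {N : Subring D}
    (hN : IsMaxSubfieldOf (grade0 𝒜) N) (h : IsGaloisExt (Subring.center D ⊓ grade0 𝒜) N) :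
    ∃ M : Subring D, IsMaxGradedSubfieldOf 𝒜 ⊤ M ∧ IsGaloisExt (Subring.center D) M := by
  have := hD.isDomain hΓ
  obtain ⟨P, hP, hFP, S, hPS, hS⟩ :=
    exists_isMaxGradedSubfieldOf_of_isMaxSubfieldOf (sep := True) hD hN fun c hc => by
      obtain ⟨l, h1, h2, h3, h4⟩ := exists_conjugates_list_of_isGaloisExt (hN.center_le hD)
        hN.1.2.1 h ⟨c, hc⟩ (exists_monic_grade0 𝒜 (hN.1.1 hc))
      refine ⟨l, h1, fun a ha => ?_, fun _ => h2, h4⟩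
      obtain ⟨σ, -, rfl⟩ := h3 a ha
      exact (σ _).2
  exact ⟨P, hP, isGaloisExt_of_isSplitRoot hFP hP.1.2
    (fun f hf hf0 x _ hfx => mem_center_of_mul_mem hf hf0 hfx) S hPS hS⟩

theorem exists_isMaxGradedSubfieldOf_isNormalExtGr {N : Subring D}
    (hN : IsMaxSubfieldOf (grade0 𝒜) N) (h : IsNormalExt (Subring.center D ⊓ grade0 𝒜) N) :
    ∃ M : Subring D, IsMaxGradedSubfieldOf 𝒜 ⊤ M ∧ IsNormalExtGr 𝒜 (Subring.center D) M := by
  have := hD.isDomain hΓ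
  obtain ⟨P, hP, hFP, S, hPS, hS⟩ :=
    exists_isMaxGradedSubfieldOf_of_isMaxSubfieldOf (sep := False) hD hN fun c hc =>
      isSplitRoot_of_splitsIn h.1 hN.1.2.1 ⟨c, hc⟩ (exists_monic_grade0 𝒜 (hN.1.1 hc)) (h.2 c hc)
  have hnormal := isNormalExt_of_isSplitRoot hFP hP.1.2
    (fun f hf hf0 x _ hfx => mem_center_of_mul_mem hf hf0 hfx) S hPS hS
  exact ⟨P, hP, hnormal.1, fun c hc _ => hnormal.2 c hc⟩

theorem exists_isMaxSubfieldOf_isGaloisExt {M : Subring D}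
    (hM : IsMaxGradedSubfieldOf 𝒜 ⊤ M) (h : IsGaloisExt (Subring.center D) M) :
    ∃ N : Subring D, N ≤ grade0 𝒜 ∧ IsMaxSubfieldOf (grade0 𝒜) N ∧
      IsGaloisExt (Subring.center D ⊓ grade0 𝒜) N := by
  have := hD.isDomain hΓ
  obtain ⟨N, hN, hFN, hS⟩ :=
    exists_isMaxSubfieldOf_of_isMaxGradedSubfieldOf (sep := True) hD hΓ hM fun γ c _ => by
      obtain ⟨l, h1, h2, h3⟩ := exists_conjugates_list_of_isGaloisExt h.1 hM.1.2 h c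
        (exists_monic_center _)
      exact ⟨l, h1, fun _ => h2, h3⟩
  refine ⟨N, hN.1.1, hN, isGaloisExt_of_isSplitRoot hFN hN.1.2.1 (fun f hf hf0 x hx hfx =>
    ⟨mem_center_of_mul_mem hf.1 hf0 hfx.1, hN.1.1 hx⟩) N ?_ hS⟩
  rw [Set.union_eq_self_of_subset_left hFN, Subring.closure_eq]

theorem exists_isMaxSubfieldOf_isNormalExt {M : Subring D}
    (hM : IsMaxGradedSubfieldOf 𝒜 ⊤ M) (h : IsNormalExtGr 𝒜 (Subring.center D) M) :
    ∃ N : Subring D, N ≤ grade0 𝒜 ∧ IsMaxSubfieldOf (grade0 𝒜) N ∧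
      IsNormalExt (Subring.center D ⊓ grade0 𝒜) N := by
  have := hD.isDomain hΓ
  obtain ⟨hFM, hsplit⟩ := h
  have hgen : M = Subring.closure (Subring.center D ∪ {c | c ∈ M ∧ ∃ γ, c ∈ 𝒜 γ}) := by
    refine le_antisymm (fun x hx => mem_of_forall_proj_mem 𝒜 fun γ =>
      Subring.subset_closure (Or.inr ⟨hM.1.1.1 x hx γ, γ, proj_mem 𝒜 γ x⟩)) ?_
    rw [Subring.closure_le]
    exact Set.union_subset hFM fun x hx => hx.1
  obtain ⟨N, hN, hFN, hS⟩ :=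
    exists_isMaxSubfieldOf_of_isMaxGradedSubfieldOf (sep := False) hD hΓ hM fun γ c _ =>
      exists_conjugates_list hFM hM.1.2
        (fun f hf hf0 x _ hfx => mem_center_of_mul_mem hf hf0 hfx) _ hgen
        (fun a ha => isSplitRoot_of_splitsIn hFM hM.1.2 ⟨a, ha.1⟩ (exists_monic_center _)
          (hsplit a ha.1 ha.2)) c
  refine ⟨N, hN.1.1, hN, isNormalExt_of_isSplitRoot hFN hN.1.2.1 (fun f hf hf0 x hx hfx =>
    ⟨mem_center_of_mul_mem hf.1 hf0 hfx.1, hN.1.1 hx⟩) N ?_ hS⟩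
  rw [Set.union_eq_self_of_subset_left hFN, Subring.closure_eq]

end Main

/-- graded main theorem: `D` has a maximal graded subfield Galois
(resp. normal) over `F` iff `D₀` has a maximal subfield Galois (resp. normal)
over `F₀`. -/
theorem stmt_9 {Γ : Type*} [AddCommGroup Γ] [DecidableEq Γ] {D : Type*} [Ring D]
    (hΓ : TorsionFree Γ) (𝒜 : Γ → AddSubgroup D) [GradedRing 𝒜]
    (hD : IsGradedDivisionRing 𝒜)
    (F : Subring D) (hFcen : F = Subring.center D) (hfin : finiteOver F) :
    ((∃ M : Subring D, IsMaxGradedSubfieldOf 𝒜 ⊤ M ∧ IsGaloisExt F M) ↔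
      (∃ N : Subring D, N ≤ grade0 𝒜 ∧ IsMaxSubfieldOf (grade0 𝒜) N ∧
        IsGaloisExt (F ⊓ grade0 𝒜) N)) ∧
    ((∃ M : Subring D, IsMaxGradedSubfieldOf 𝒜 ⊤ M ∧ IsNormalExtGr 𝒜 F M) ↔
      (∃ N : Subring D, N ≤ grade0 𝒜 ∧ IsMaxSubfieldOf (grade0 𝒜) N ∧
        IsNormalExt (F ⊓ grade0 𝒜) N)) := by
  subst hFcen
  have : Module.Finite (Subring.center D) D := hfin
  exact ⟨⟨fun ⟨_, hM, h⟩ => exists_isMaxSubfieldOf_isGaloisExt hD hΓ hM h,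
      fun ⟨_, _, hN, h⟩ => exists_isMaxGradedSubfieldOf_isGaloisExt hD hΓ hN h⟩,
    ⟨fun ⟨_, hM, h⟩ => exists_isMaxSubfieldOf_isNormalExt hD hΓ hM h,
      fun ⟨_, _, hN, h⟩ => exists_isMaxGradedSubfieldOf_isNormalExtGr hD hΓ hN h⟩⟩

end GradedDivPaper
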